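/- arXiv:2106.06730 — 2 statements merged into one kernel-verified Lean document; each statement's English description precedes it below -/
import Mathlib

section
/- Let T be a quartic form in five variables with a decomposition A of length r ≤ 11 satisfying: A is non-redundant, the first Kruskal rank k_1(A) = 5, the second Kruskal rank k_2(A) = r, and the base locus Q of the linear system of quadric hypersurfaces through A is finite of length at most 16. Then T is identifiable of rank r: the decomposition A is, up to scalars and reordering, the unique decomposition of T of length at most r. -/
open MvPolynomial

noncomputable section

/-- Projective n-space over ℂ. -/
abbrev Pn (n : ℕ) := Projectivization ℂ (Fin (n + 1) → ℂ)

/-- Evaluation of a polynomial at a vector, as a linear map. -/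
noncomputable def evalAt {n : ℕ} (v : Fin (n + 1) → ℂ) :
    MvPolynomial (Fin (n + 1)) ℂ →ₗ[ℂ] ℂ :=
  (MvPolynomial.aeval v).toLinearMap

/-- The degree-`j` homogeneous piece of the polynomial ring `R = ℂ[x_0,…,x_n]`. -/
abbrev Rdeg (n j : ℕ) : Submodule ℂ (MvPolynomial (Fin (n + 1)) ℂ) :=
  MvPolynomial.homogeneousSubmodule (Fin (n + 1)) ℂ j

/-- Evaluation of degree-`j` forms at the points of a finite set `Z ⊂ ℙⁿ`
(using chosen representatives; its rank does not depend on the choice). -/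
noncomputable def evalMap {n : ℕ} (Z : Finset (Pn n)) (j : ℕ) :
    (Rdeg n j) →ₗ[ℂ] (Z → ℂ) :=
  (LinearMap.pi fun z : Z => evalAt (z : Pn n).rep).comp (Rdeg n j).subtype

/-- Hilbert function of a finite set of points `Z ⊂ ℙⁿ`. -/
noncomputable def hilb {n : ℕ} (Z : Finset (Pn n)) (j : ℕ) : ℕ :=
  Module.finrank ℂ (LinearMap.range (evalMap Z j))

/-- First difference of the Hilbert function (the `h`-vector entries). -/
noncomputable def Dh {n : ℕ} (Z : Finset (Pn n)) : ℕ → ℕ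
  | 0 => hilb Z 0
  | (j + 1) => hilb Z (j + 1) - hilb Z j

/-- The Cayley–Bacharach property `CB(i)`: every degree-`i` form vanishing on
`Z ∖ {P}` also vanishes at `P`, for every `P ∈ Z`. -/
def CB {n : ℕ} (Z : Finset (Pn n)) (i : ℕ) : Prop :=
  ∀ P ∈ Z, ∀ f ∈ Rdeg n i,
    (∀ Q ∈ Z, Q ≠ P → evalAt (Q : Pn n).rep f = 0) → evalAt P.rep f = 0

/-- The `d`-th power of the linear form corresponding to a point `P ∈ ℙⁿ`,
i.e. the image of `P` under the degree-`d` Veronese map (rep-scaled). -/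
noncomputable def powForm (n d : ℕ) (P : Pn n) : MvPolynomial (Fin (n + 1)) ℂ :=
  (∑ i, P.rep i • MvPolynomial.X i) ^ d

/-- `A` computes (is a decomposition of) the degree-`d` form `T`:
`T` lies in the span of the `d`-th powers of the linear forms given by `A`. -/
def computes (n d : ℕ) (A : Finset (Pn n)) (T : MvPolynomial (Fin (n + 1)) ℂ) : Prop :=
  T ∈ Submodule.span ℂ (powForm n d '' (A : Set (Pn n)))

/-- `A` is a non-redundant decomposition of `T`. -/
def nonRedundant (n d : ℕ) (A : Finset (Pn n)) (T : MvPolynomial (Fin (n + 1)) ℂ) : Prop :=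
  computes n d A T ∧ ∀ A' : Finset (Pn n), A' ⊂ A → ¬ computes n d A' T

/-- The `d`-th Kruskal rank of `A` is `≥ k`: all subsets of `v_d(A)` of
cardinality at most `k` are linearly independent. -/
def kruskalGe (n d : ℕ) (A : Finset (Pn n)) (k : ℕ) : Prop :=
  ∀ S : Finset (Pn n), S ⊆ A → S.card ≤ k →
    LinearIndependent ℂ (fun P : S => powForm n d P.1)

/-- Quadrics through `A`. -/
def quadricsThrough (n : ℕ) (A : Finset (Pn n)) : Set (MvPolynomial (Fin (n + 1)) ℂ) :=
  {f | f ∈ Rdeg n 2 ∧ ∀ P ∈ A, evalAt P.rep f = 0}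

/-- Base locus of the linear system of quadric hypersurfaces through `A`. -/
def baseLocusQ (n : ℕ) (A : Finset (Pn n)) : Set (Pn n) :=
  {Q | ∀ f ∈ quadricsThrough n A, evalAt Q.rep f = 0}

/-- Waring rank of a form `T`. -/
noncomputable def waringRank (n d : ℕ) (T : MvPolynomial (Fin (n + 1)) ℂ) : ℕ :=
  sInf {r | ∃ B : Finset (Pn n), B.card = r ∧ computes n d B T}

/-- Degree-`d` graded piece of the homogeneous ideal of `Z`. -/
noncomputable def idealDeg (n : ℕ) (Z : Finset (Pn n)) (d : ℕ) :
    Submodule ℂ (MvPolynomial (Fin (n + 1)) ℂ) :=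
  Rdeg n d ⊓ ⨅ P ∈ Z, LinearMap.ker (evalAt (P : Pn n).rep)

end

open scoped Classical


lemma evalAt_eq_sum {n : ℕ} (v : Fin (n + 1) → ℂ) (f : MvPolynomial (Fin (n + 1)) ℂ) :
    evalAt v f = ∑ s ∈ f.support, f.coeff s * s.prod (fun i m => v i ^ m) := by
  simp only [evalAt, AlgHom.toLinearMap_apply, MvPolynomial.aeval_def, MvPolynomial.eval₂_eq,
    Finsupp.prod]
  rfl

lemma evalAt_mul {n : ℕ} (v : Fin (n + 1) → ℂ) (f g : MvPolynomial (Fin (n + 1)) ℂ) :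
    evalAt v (f * g) = evalAt v f * evalAt v g := by
  simp [evalAt]

/-- A relation among powers is a relation among evaluation functionals. -/
lemma rel_iff (n d : ℕ) (S : Finset (Pn n)) (c : Pn n → ℂ) :
    (∑ P ∈ S, c P • powForm n d P = 0) ↔
      ∀ f ∈ Rdeg n d, ∑ P ∈ S, c P * evalAt P.rep f = 0 := by
  have key : ∀ s : Fin (n + 1) →₀ ℕ, coeff s (∑ P ∈ S, c P • powForm n d P) =
      if s.sum (fun _ m ↦ m) = d then
        s.multinomial * ∑ P ∈ S, c P * s.prod (fun i m => P.rep i ^ m) else 0 := by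
    intro s
    simp only [coeff_sum, coeff_smul, powForm, coeff_linearCombination_X_pow_of_fintype]
    split_ifs with h
    · rw [Finset.mul_sum]
      refine Finset.sum_congr rfl fun P _ => ?_
      simp only [smul_eq_mul]; ring
    · simp
  constructor
  · intro h f hf
    have h1 : ∀ s ∈ f.support, ∑ P ∈ S, c P * s.prod (fun i m => P.rep i ^ m) = 0 := by
      intro s hs
      have hd : s.sum (fun _ m ↦ m) = d := by
        have := (mem_homogeneousSubmodule _ _).1 hf (mem_support_iff.1 hs)
        simpa [Finsupp.weight_apply] using this
      have h2 := key s
      rw [h, if_pos hd, coeff_zero] at h2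
      rcases mul_eq_zero.1 h2.symm with h3 | h3
      · exact absurd (by exact_mod_cast h3) (Nat.multinomial_pos _ _).ne'
      · exact h3
    simp only [evalAt_eq_sum, Finset.mul_sum]
    rw [Finset.sum_comm]
    refine Finset.sum_eq_zero fun s hs => ?_
    calc _ = coeff s f * ∑ P ∈ S, c P * s.prod (fun i m => P.rep i ^ m) := by
          rw [Finset.mul_sum]
          exact Finset.sum_congr rfl fun P _ => by ring
      _ = 0 := by rw [h1 s hs, mul_zero]
  · intro h
    ext s
    rw [key, coeff_zero]
    split_ifs with hs
    · have := h (monomial s 1) ((mem_homogeneousSubmodule _ _).2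
        (isHomogeneous_monomial _ (by exact hs)))
      have h3 : ∀ P : Pn n, evalAt P.rep (monomial s (1 : ℂ)) =
          s.prod (fun i m => P.rep i ^ m) := by
        intro P; simp [evalAt, aeval_monomial]
      simp only [h3] at this
      rw [this, mul_zero]
    · rfl

/-- Independence of the `d`-th powers gives interpolation by forms of degree `d`. -/
lemma interp (n d : ℕ) (A : Finset (Pn n)) (h : kruskalGe n d A A.card) (P : Pn n) :
    ∃ q ∈ Rdeg n d, ∀ P' ∈ A, evalAt P'.rep q = if P = P' then 1 else 0 := by
  have hs : LinearMap.range (evalMap A d) = ⊤ := by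
    by_contra hne
    obtain ⟨φ, hφ, hle⟩ := Submodule.exists_le_ker_of_lt_top _ (lt_top_iff_ne_top.2 hne)
    apply hφ
    let c : Pn n → ℂ := fun Q => if hQ : Q ∈ A then φ (Pi.single ⟨Q, hQ⟩ 1) else 0
    have hφc : ∀ x : A → ℂ, φ x = ∑ Q : A, c Q * x Q := by
      intro x
      rw [LinearMap.pi_apply_eq_sum_univ φ x]
      refine Finset.sum_congr rfl fun Q _ => ?_
      have : (fun j => if Q = j then (1 : ℂ) else 0) = Pi.single Q 1 := by
        ext j; simp [Pi.single_apply, eq_comm]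
      simp [c, this, mul_comm]
    have hrel : ∑ Q ∈ A, c Q • powForm n d Q = 0 := by
      rw [rel_iff]
      intro f hf
      have h1 : φ (evalMap A d ⟨f, hf⟩) = 0 := hle ⟨_, rfl⟩
      rw [hφc] at h1
      rw [← Finset.sum_coe_sort]
      exact h1
    have hli := h A (Finset.Subset.refl _) le_rfl
    rw [Fintype.linearIndependent_iff] at hli
    have h0 := hli (fun Q => c Q) (by
      rw [← Finset.sum_coe_sort] at hrel; exact hrel)
    refine LinearMap.ext fun x => ?_
    simp [hφc, h0]
  have : (fun Q : A => if P = Q.1 then (1 : ℂ) else 0) ∈ LinearMap.range (evalMap A d) := by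
    rw [hs]; trivial
  obtain ⟨⟨q, hq⟩, hq2⟩ := this
  refine ⟨q, hq, fun P' hP' => ?_⟩
  exact congrFun hq2 ⟨P', hP'⟩

/-- The linear form with coefficient vector `m`. -/
noncomputable def linForm (m : Fin 5 → ℂ) : MvPolynomial (Fin 5) ℂ := ∑ i, m i • X i

lemma linForm_mem (m : Fin 5 → ℂ) : linForm m ∈ Rdeg 4 1 := by
  refine Submodule.sum_mem _ fun i _ => Submodule.smul_mem _ _ ?_
  exact (mem_homogeneousSubmodule _ _).2 (isHomogeneous_X _ _)

lemma evalAt_linForm (m v : Fin 5 → ℂ) : evalAt (n := 4) v (linForm m) = m ⬝ᵥ v := by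
  simp [linForm, evalAt, dotProduct]

lemma mul_mem_Rdeg {n i j : ℕ} {f g : MvPolynomial (Fin (n + 1)) ℂ} (hf : f ∈ Rdeg n i)
    (hg : g ∈ Rdeg n j) : f * g ∈ Rdeg n (i + j) :=
  (mem_homogeneousSubmodule _ _).2
    (((mem_homogeneousSubmodule _ _).1 hf).mul ((mem_homogeneousSubmodule _ _).1 hg))

/-- Kruskal's argument: a square cannot be a combination of at most eight squares in
linearly general position. -/
lemma kruskal_step (W : Finset (Pn 4)) (M : Pn 4) (hM : M ∉ W) (hne : W.Nonempty)
    (hW8 : W.card ≤ 8) (hk : kruskalGe 4 1 W 5) (c : Pn 4 → ℂ) (hc : ∀ P ∈ W, c P ≠ 0) (b : ℂ)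
    (h : ∀ p ∈ Rdeg 4 2, ∑ P ∈ W, c P * evalAt P.rep p = b * evalAt M.rep p) : False := by
  -- forms vanishing at `M` and outside five points of `W` vanish on `W`
  have step : ∀ S ⊆ W, S.card ≤ 5 → ∀ m : Fin 5 → ℂ, m ⬝ᵥ M.rep = 0 →
      (∀ P ∈ W, P ∉ S → m ⬝ᵥ P.rep = 0) → ∀ P ∈ W, m ⬝ᵥ P.rep = 0 := by
    intro S hSW hS m hmM hmS
    have hrel : ∑ P ∈ S, (c P * (m ⬝ᵥ P.rep)) • powForm 4 1 P = 0 := by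
      rw [rel_iff]
      intro l hl
      have h1 := h _ (mul_mem_Rdeg (linForm_mem m) hl)
      simp only [evalAt_mul, evalAt_linForm, hmM, zero_mul, mul_zero] at h1
      rw [← h1, ← Finset.sum_subset hSW]
      · exact Finset.sum_congr rfl fun P _ => by ring
      · intro P hP hPS
        rw [hmS P hP hPS]; ring
    have hli := hk S hSW hS
    rw [Fintype.linearIndependent_iff] at hli
    have h0 := hli (fun Q => c Q * (m ⬝ᵥ Q.1.rep)) (by
      rw [← Finset.sum_coe_sort] at hrel; exact hrel)
    intro P hP
    by_cases hPS : P ∈ S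
    · exact (mul_eq_zero.1 (h0 ⟨P, hPS⟩)).resolve_left (hc P hP)
    · exact hmS P hP hPS
  by_cases h5 : W.card ≤ 5
  · obtain ⟨P, hP⟩ := hne
    have hPM : P ≠ M := fun e => hM (e ▸ hP)
    have hli : LinearIndependent ℂ ![P.rep, M.rep] :=
      Projectivization.linearIndependent_pair_iff_ne.2 hPM
    have hnot : P.rep ∉ Submodule.span ℂ {M.rep} := by
      intro hmem
      obtain ⟨t, ht⟩ := Submodule.mem_span_singleton.1 hmem
      have := (LinearIndependent.pair_iff.1 hli) 1 (-t) (by rw [← ht]; simp)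
      exact one_ne_zero this.1
    obtain ⟨φ, hφ, hφ2⟩ := Submodule.exists_le_ker_of_notMem hnot
    have hφd : ∀ v, φ v = (fun i => φ (Pi.single i 1)) ⬝ᵥ v := by
      intro v
      rw [LinearMap.pi_apply_eq_sum_univ φ v, dotProduct]
      refine Finset.sum_congr rfl fun Q _ => ?_
      have : (fun j => if Q = j then (1 : ℂ) else 0) = Pi.single Q 1 := by
        ext j; simp [Pi.single_apply, eq_comm]
      simp [this, mul_comm]
    apply hφ
    rw [hφd]
    refine step W (Finset.Subset.refl _) h5 _ ?_ (fun P hP hP' => absurd hP hP') P hP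
    rw [← hφd]
    exact hφ2 (Submodule.mem_span_singleton_self _)
  · push Not at h5
    obtain ⟨S, hSW, hS⟩ := Finset.exists_subset_card_eq (s := W) (n := 5) (by omega)
    let N : Finset (Pn 4) := insert M (W \ S)
    have hN : N.card < 5 := by
      have h1 := Finset.card_insert_le M (W \ S)
      have h2 := Finset.card_sdiff_add_card_eq_card hSW
      show (insert M (W \ S)).card < 5
      omega
    let F : (Fin 5 → ℂ) →ₗ[ℂ] (N → ℂ) := Matrix.mulVecLin (fun P : N => P.1.rep)
    have hF : LinearMap.ker F ≠ ⊥ := LinearMap.ker_ne_bot_of_finrank_lt (by simpa using hN)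
    obtain ⟨m, hm, hm0⟩ := (Submodule.ne_bot_iff _).mp hF
    have hmN : ∀ P ∈ N, m ⬝ᵥ P.rep = 0 := by
      intro P hP
      rw [dotProduct_comm]
      exact congrFun (LinearMap.mem_ker.1 hm) ⟨P, hP⟩
    have hmW := step S hSW hS.le m (hmN M (Finset.mem_insert_self _ _)) (fun P hP hPS =>
      hmN P (Finset.mem_insert_of_mem (Finset.mem_sdiff.2 ⟨hP, hPS⟩)))
    have hker : Submodule.span ℂ (Set.range fun P : S => P.1.rep) = ⊤ := by
      have hli : LinearIndependent ℂ (fun P : S => P.1.rep) := by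
        have := hk S hSW hS.le
        rw [Fintype.linearIndependent_iff] at this ⊢
        intro g hg
        refine this g ?_
        have h2 : ∀ P : S, powForm 4 1 P.1 = Fintype.linearCombination ℂ
          (fun i : Fin 5 => (X i : MvPolynomial (Fin 5) ℂ)) P.1.rep := by
          intro P
          simp [powForm, Fintype.linearCombination_apply]
        simp only [h2, ← map_smul, ← map_sum]
        rw [hg, map_zero]
      refine hli.span_eq_top_of_card_eq_finrank' ?_
      simp [hS]
    apply hm0
    have hle : Submodule.span ℂ (Set.range fun P : S => P.1.rep) ≤
        LinearMap.ker (dotProductBilin ℂ ℂ m) := by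
      rw [Submodule.span_le]
      rintro _ ⟨P, rfl⟩
      exact hmW P.1 (hSW P.2)
    rw [hker] at hle
    ext i
    have : m ⬝ᵥ Pi.single i 1 = 0 := hle (Submodule.mem_top (x := Pi.single i 1))
    simpa using this

/-- Catalecticant argument comparing two decompositions. -/
lemma compare_decomp (A B : Finset (Pn 4)) (a b : Pn 4 → ℂ) (ha : ∀ P ∈ A, a P ≠ 0)
    (hk2 : kruskalGe 4 2 A A.card)
    (hrel : ∀ f ∈ Rdeg 4 4, ∑ P ∈ A, a P * evalAt P.rep f = ∑ P ∈ B, b P * evalAt P.rep f) :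
    A.card ≤ B.card ∧ (B.card ≤ A.card →
      (∀ M ∈ B, ∃ q ∈ Rdeg 4 2, ∀ P ∈ B, evalAt P.rep q = if M = P then 1 else 0) ∧
      (∀ f ∈ Rdeg 4 2, (∀ P ∈ A, evalAt P.rep f = 0) ↔ ∀ P ∈ B, evalAt P.rep f = 0)) := by
  choose q hq hqv using fun P => interp 4 2 A hk2 P
  have hBA : ∀ f ∈ Rdeg 4 2, (∀ P ∈ B, evalAt P.rep f = 0) → ∀ P ∈ A, evalAt P.rep f = 0 := by
    intro f hf hfB P hP
    have h1 := hrel _ (mul_mem_Rdeg hf (hq P))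
    simp only [evalAt_mul] at h1
    rw [Finset.sum_eq_zero (s := B) (fun P hP => by rw [hfB P hP]; ring),
      Finset.sum_eq_single P, hqv P P hP, if_pos rfl, mul_one] at h1
    · exact (mul_eq_zero.1 h1).resolve_left (ha P hP)
    · intro P' hP' hne
      rw [hqv P P' hP', if_neg hne.symm]; ring
    · exact fun h => absurd hP h
  let G : (A → ℂ) →ₗ[ℂ] (Rdeg 4 2) := Fintype.linearCombination ℂ (fun P : A => ⟨q P, hq P⟩)
  have hG : ∀ (x : A → ℂ) (P : A), evalAt P.1.rep (G x : MvPolynomial (Fin 5) ℂ) = x P := by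
    intro x P
    simp only [G, Fintype.linearCombination_apply, Submodule.coe_sum, Submodule.coe_smul,
      map_sum, map_smul]
    rw [Finset.sum_eq_single P]
    · rw [hqv _ _ P.2]; simp
    · intro P' _ hne
      rw [hqv _ _ P.2, if_neg (fun h => hne (Subtype.ext h))]; simp
    · simp
  let E : (A → ℂ) →ₗ[ℂ] (B → ℂ) := (evalMap B 2).comp G
  have hE : ∀ x (P : B), E x P = evalAt P.1.rep (G x : MvPolynomial (Fin 5) ℂ) := fun _ _ => rfl
  have hEinj : Function.Injective E := by
    rw [← LinearMap.ker_eq_bot, LinearMap.ker_eq_bot']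
    intro x hx
    ext P
    rw [← hG x P]
    refine hBA _ (G x).2 (fun Q hQ => ?_) P.1 P.2
    exact congrFun hx ⟨Q, hQ⟩
  have hle := LinearMap.finrank_le_finrank_of_injective hEinj
  simp only [Module.finrank_fintype_fun_eq_card, Fintype.card_coe] at hle
  refine ⟨hle, fun hge => ?_⟩
  have hEsurj : Function.Surjective E :=
    (LinearMap.injective_iff_surjective_of_finrank_eq_finrank
      (by simp only [Module.finrank_fintype_fun_eq_card, Fintype.card_coe]; omega)).1 hEinj
  refine ⟨fun M hM => ?_, fun f hf => ⟨fun hfA => ?_, hBA f hf⟩⟩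
  · obtain ⟨x, hx⟩ := hEsurj (fun P => if M = P.1 then 1 else 0)
    exact ⟨G x, (G x).2, fun P hP => congrFun hx ⟨P, hP⟩⟩
  · obtain ⟨x, hx⟩ := hEsurj (fun P => evalAt P.1.rep f)
    have hx' : ∀ P ∈ B, evalAt P.rep (G x : MvPolynomial (Fin 5) ℂ) = evalAt P.rep f :=
      fun P hP => congrFun hx ⟨P, hP⟩
    have h1 := hBA ((G x : MvPolynomial (Fin 5) ℂ) - f) (Submodule.sub_mem _ (G x).2 hf)
      (fun P hP => by rw [map_sub, hx' P hP, sub_self])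
    have hx0 : x = 0 := by
      ext P
      have h2 := h1 P.1 P.2
      rw [map_sub, hfA P.1 P.2, sub_zero, hG] at h2
      exact h2
    intro P hP
    rw [← hx' P hP, hx0]
    simp

/-- A quartic in five variables with a decomposition `A` of length
`r ≤ 11` satisfying (i) non-redundancy, (ii) `k₁(A)=5`, (iii) `k₂(A)=r`,
(iv) finite quadric base locus of length `≤ 16`, is identifiable of rank `r`. -/
theorem stmt3 (r : ℕ) (hr : r ≤ 11) (T : MvPolynomial (Fin 5) ℂ)
    (hT : T.IsHomogeneous 4) (A : Finset (Pn 4)) (hcard : A.card = r)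
    (hi : nonRedundant 4 4 A T) (hk1 : kruskalGe 4 1 A 5) (hk2 : kruskalGe 4 2 A r)
    (hQfin : (baseLocusQ 4 A).Finite) (hQ16 : (baseLocusQ 4 A).ncard ≤ 16) :
    waringRank 4 4 T = r ∧
      ∀ B : Finset (Pn 4), computes 4 4 B T → B.card ≤ r → B = A := by
  obtain ⟨hAT, hmin⟩ := hi
  obtain ⟨a, haT⟩ := (Submodule.mem_span_image_finset_iff_exists_fun' ℂ).1 hAT
  have ha : ∀ P ∈ A, a P ≠ 0 := by
    intro P hP h0
    refine hmin (A.erase P) (Finset.erase_ssubset hP) ?_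
    refine (Submodule.mem_span_image_finset_iff_exists_fun' ℂ).2 ⟨a, ?_⟩
    rw [← haT, ← Finset.add_sum_erase _ _ hP, h0, zero_smul, zero_add]
  rw [← hcard] at hk2
  have hcmp : ∀ B : Finset (Pn 4), computes 4 4 B T → ∃ b : Pn 4 → ℂ,
      ∀ f ∈ Rdeg 4 4, ∑ P ∈ A, a P * evalAt P.rep f = ∑ P ∈ B, b P * evalAt P.rep f := by
    intro B hB
    obtain ⟨b, hbT⟩ := (Submodule.mem_span_image_finset_iff_exists_fun' ℂ).1 hB
    refine ⟨b, fun f hf => ?_⟩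
    let c : Pn 4 → ℂ := fun P => (if P ∈ A then a P else 0) - (if P ∈ B then b P else 0)
    have hc : ∑ P ∈ A ∪ B, c P • powForm 4 4 P = 0 := by
      simp only [c, sub_smul, ite_smul, zero_smul, Finset.sum_sub_distrib, Finset.sum_ite_mem,
        Finset.union_inter_cancel_left, Finset.union_inter_cancel_right]
      rw [haT, hbT, sub_self]
    have h1 := (rel_iff _ _ _ _).1 hc f hf
    simp only [c, sub_mul, ite_mul, zero_mul, Finset.sum_sub_distrib, Finset.sum_ite_mem,
        Finset.union_inter_cancel_left, Finset.union_inter_cancel_right] at h1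
    exact sub_eq_zero.1 h1
  constructor
  · refine le_antisymm (Nat.sInf_le ⟨A, hcard, hAT⟩) ?_
    refine le_csInf ⟨r, A, hcard, hAT⟩ ?_
    rintro _ ⟨B, rfl, hB⟩
    obtain ⟨b, hb⟩ := hcmp B hB
    rw [← hcard]
    exact (compare_decomp A B a b ha hk2 hb).1
  · intro B hB hBr
    obtain ⟨b, hb⟩ := hcmp B hB
    obtain ⟨hle, h2⟩ := compare_decomp A B a b ha hk2 hb
    obtain ⟨hBint, hAB⟩ := h2 (hcard ▸ hBr)
    by_contra hne
    have hnsub : ¬ B ⊆ A := fun hs => hne (Finset.eq_of_subset_of_card_le hs hle)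
    obtain ⟨M, hMB, hMA⟩ := Finset.not_subset.1 hnsub
    obtain ⟨q, hq, hqv⟩ := hBint M hMB
    -- the union lies in the base locus
    have hQ : ((A ∪ B : Finset (Pn 4)) : Set (Pn 4)) ⊆ baseLocusQ 4 A := by
      intro P hP f hf
      rcases Finset.mem_union.1 (Finset.mem_coe.1 hP) with h | h
      · exact hf.2 P h
      · exact (hAB f hf.1).1 hf.2 P h
    have hU : (A ∪ B).card ≤ 16 := by
      have := Set.ncard_le_ncard hQ hQfin
      rw [Set.ncard_coe_finset] at this
      omega
    have hAmB : (A \ B).card ≤ 8 := by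
      have h3 : (A \ B).card + B.card = (A ∪ B).card := Finset.card_sdiff_add_card A B
      have h4 := Finset.card_le_card (Finset.sdiff_subset (s := A) (t := B))
      omega
    let c : Pn 4 → ℂ := fun P => a P * evalAt P.rep q
    let W := A.filter (fun P => c P ≠ 0)
    have hWsub : W ⊆ A \ B := by
      intro P hP
      obtain ⟨hPA, hPc⟩ := Finset.mem_filter.1 hP
      refine Finset.mem_sdiff.2 ⟨hPA, fun hPB => hPc ?_⟩
      have : M ≠ P := fun e => hMA (e ▸ hPA)
      simp [c, hqv P hPB, this]
    have hWA : W ⊆ A := Finset.filter_subset _ _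
    refine kruskal_step W M (fun h => hMA (hWA h)) ?_ ((Finset.card_le_card hWsub).trans hAmB)
      (fun S hS => hk1 S (hS.trans hWA)) c (fun P hP => (Finset.mem_filter.1 hP).2) (b M) ?_
    · by_contra hemp
      rw [Finset.not_nonempty_iff_eq_empty, Finset.filter_eq_empty_iff] at hemp
      have hqA : ∀ P ∈ A, evalAt P.rep q = 0 := by
        intro P hP
        have h3 : c P = 0 := not_not.1 (hemp hP)
        exact (mul_eq_zero.1 h3).resolve_left (ha P hP)
      have h3 := (hAB q hq).1 hqA M hMB
      rw [hqv M hMB, if_pos rfl] at h3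
      exact one_ne_zero h3
    · intro p hp
      have h3 := hb _ (mul_mem_Rdeg hq hp)
      simp only [evalAt_mul] at h3
      rw [Finset.sum_eq_single (s := B) M, hqv M hMB, if_pos rfl, one_mul] at h3
      · rw [← h3, Finset.sum_subset hWA]
        · exact Finset.sum_congr rfl fun P _ => by simp only [c]; ring
        · intro P hP hPW
          have : c P = 0 := by
            by_contra h0
            exact hPW (Finset.mem_filter.2 ⟨hP, h0⟩)
          rw [this, zero_mul]
      · intro P hP hne'
        rw [hqv P hP, if_neg hne'.symm]; ring
      · exact fun h => absurd hMB h
end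

section
/- Let A and B be finite sets in P^n linked by a complete intersection Z of type (d_1,...,d_n) (so Z = A ∪ B with A, B disjoint). Then for every integer i, Dh_B(i) + Dh_A(d_1 + ... + d_n - n - i) = Dh_Z(i). -/
open MvPolynomial

open scoped Classical


/-- `Dh` extended to integer arguments (zero for negative degrees). -/
noncomputable def DhZint {n : ℕ} (Z : Finset (Pn n)) (i : ℤ) : ℕ :=
  if 0 ≤ i then Dh Z i.toNat else 0

namespace Liaison

theorem mem_powIdeal {σ S : Type*} [CommRing S] (N : ℕ) (I : Set σ) (h : MvPolynomial σ S) :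
    h ∈ Ideal.span ((fun k => (X k : MvPolynomial σ S) ^ N) '' I) ↔
      ∀ a : σ →₀ ℕ, (∀ k ∈ I, a k < N) → coeff a h = 0 := by
  have e : ((fun k => (X k : MvPolynomial σ S) ^ N) '' I) =
      (fun s => monomial s (1 : S)) '' ((fun k => Finsupp.single k N) '' I) := by
    rw [Set.image_image]
    simp only [X_pow_eq_monomial]
  rw [e, mem_ideal_span_monomial_image]
  constructor
  · intro H a ha
    by_contra hc
    obtain ⟨s, ⟨k, hk, rfl⟩, hs⟩ := H a (mem_support_iff.2 hc)
    have := hs k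
    simp at this
    exact absurd (ha k hk) (by omega)
  · intro H a ha
    by_contra hc
    push Not at hc
    refine (mem_support_iff.1 ha) (H a fun k hk => ?_)
    by_contra hk'
    refine hc (Finsupp.single k N) ⟨k, hk, rfl⟩ ?_
    rw [Finsupp.single_le_iff]
    omega

theorem nzd_powIdeal {σ S : Type*} [CommRing S] (N : ℕ) (I : Set σ) (h : MvPolynomial σ S)
    (i : σ) (hi : i ∉ I) (y : S) (hy : y ^ N = 0)
    (H : (X i - C y) * h ∈ Ideal.span ((fun k => (X k : MvPolynomial σ S) ^ N) '' I)) :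
    h ∈ Ideal.span ((fun k => (X k : MvPolynomial σ S) ^ N) '' I) := by
  rw [mem_powIdeal] at H ⊢
  have key : ∀ a : σ →₀ ℕ, (∀ k ∈ I, a k < N) →
      coeff a h = y * coeff (a + Finsupp.single i 1) h := by
    intro a ha
    have := H (a + Finsupp.single i 1) (by
      intro k hk
      have : i ≠ k := by rintro rfl; exact hi hk
      simpa [Finsupp.single_apply, this] using ha k hk)
    rw [sub_mul, coeff_sub, coeff_C_mul, mul_comm (X i), coeff_mul_X] at this
    exact sub_eq_zero.1 this
  have key2 : ∀ r : ℕ, ∀ a : σ →₀ ℕ, (∀ k ∈ I, a k < N) →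
      coeff a h = y ^ r * coeff (a + Finsupp.single i r) h := by
    intro r
    induction r with
    | zero => intro a ha; simp
    | succ r ih =>
      intro a ha
      rw [ih a ha, key (a + Finsupp.single i r)]
      · rw [add_assoc, ← Finsupp.single_add, pow_succ, mul_assoc]
      · intro k hk
        have : i ≠ k := by rintro rfl; exact hi hk
        simpa [Finsupp.single_apply, this] using ha k hk
  intro a ha
  rw [key2 N a ha, hy, zero_mul]

/-- Row-by-row comparison of determinants. -/
theorem det_congr {σ S : Type*} [Fintype σ] [DecidableEq σ] [CommRing S] (N : ℕ) (y : σ → S)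
    (hy : ∀ i, y i ^ N = 0)
    (M : Matrix σ σ (MvPolynomial σ S)) (q : σ → MvPolynomial σ S)
    (hM : ∀ i, ∑ k, M i k * (X k - C (y k)) = X i ^ N)
    (hq : ∀ i, q i * (X i - C (y i)) = X i ^ N) :
    M.det - ∏ i, q i ∈
      Ideal.span ((fun k => (X k : MvPolynomial σ S) ^ N) '' Set.univ) := by
  let G : Finset σ → Matrix σ σ (MvPolynomial σ S) := fun I =>
    Matrix.of fun i => if i ∈ I then M i else Matrix.diagonal q i
  have hG : ∀ I i, ∑ k, G I i k * (X k - C (y k)) = X i ^ N := by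
    intro I i
    by_cases hi : i ∈ I
    · simp only [G, Matrix.of_apply, hi, if_true]; exact hM i
    · simp only [G, Matrix.of_apply, hi, if_false]
      rw [← hq i]
      simp [Matrix.diagonal_apply]
  have main : ∀ I, (G I).det - ∏ i, q i ∈
      Ideal.span ((fun k => (X k : MvPolynomial σ S) ^ N) '' Set.univ) := by
    intro I
    induction I using Finset.induction_on with
    | empty =>
      have : G ∅ = Matrix.diagonal q := by ext i j; simp [G]
      rw [this, Matrix.det_diagonal, sub_self]
      exact Ideal.zero_mem _
    | insert i I hi ih =>
      set r : σ → MvPolynomial σ S := M i - Matrix.diagonal q i with hr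
      set E := (G I).updateRow i r with hE
      have h1 : G (insert i I) = (G I).updateRow i (Matrix.diagonal q i + r) := by
        ext j k
        by_cases hj : j = i
        · subst hj; simp [G, hr]
        · simp [G, hj]
      have h2 : (G I).updateRow i (Matrix.diagonal q i) = G I := by
        ext j k
        by_cases hj : j = i
        · subst hj; simp [G, hi]
        · simp [Matrix.updateRow_ne hj]
      have h3 : (G (insert i I)).det = (G I).det + E.det := by
        rw [h1, Matrix.det_updateRow_add, h2]
      have h4 : E.det ∈ Ideal.span ((fun k => (X k : MvPolynomial σ S) ^ N) '' {i}ᶜ) := by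
        apply nzd_powIdeal N _ _ i (by simp) (y i) (hy i)
        let w : σ → MvPolynomial σ S := fun k => X k - C (y k)
        have h5 : E.det * w i = ∑ k, E.adjugate i k * (E.mulVec w) k := by
          have : E.adjugate.mulVec (E.mulVec w) = E.det • w := by
            rw [Matrix.mulVec_mulVec, Matrix.adjugate_mul, Matrix.smul_mulVec, Matrix.one_mulVec]
          have := congrFun this i
          simp only [Pi.smul_apply, smul_eq_mul] at this
          rw [← this]; rfl
        rw [mul_comm]
        change E.det * w i ∈ _
        rw [h5]
        refine Ideal.sum_mem _ fun k _ => Ideal.mul_mem_left _ _ ?_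
        by_cases hk : k = i
        · subst hk
          have : E.mulVec w k = 0 := by
            simp only [Matrix.mulVec, dotProduct, hE, Matrix.updateRow_self, hr, Pi.sub_apply, sub_mul,
              Finset.sum_sub_distrib, w]
            rw [hM k, ← hq k]
            simp [Matrix.diagonal_apply]
          rw [this]; exact Ideal.zero_mem _
        · have : E.mulVec w k = X k ^ N := by
            simp only [Matrix.mulVec, dotProduct, hE, Matrix.updateRow_ne hk, w]
            exact hG I k
          rw [this]
          exact Ideal.subset_span ⟨k, by simpa using hk, rfl⟩
      rw [h3, add_sub_right_comm]
      exact Ideal.add_mem _ ih (Ideal.span_mono (Set.image_mono (Set.subset_univ _)) h4)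
  have := main Finset.univ
  have e : G Finset.univ = M := by ext i j; simp [G]
  rwa [e] at this

theorem sub_eval_mem {σ S : Type*} [CommRing S] (y : σ → S) (p : MvPolynomial σ S) :
    p - C (eval y p) ∈ Ideal.span (Set.range fun k => (X k - C (y k) : MvPolynomial σ S)) := by
  induction p using MvPolynomial.induction_on with
  | C a => simp
  | add p q hp hq =>
    have : p + q - C (eval y (p + q)) = (p - C (eval y p)) + (q - C (eval y q)) := by
      simp; ring
    rw [this]; exact Ideal.add_mem _ hp hq
  | mul_X p i hp =>
    have : p * X i - C (eval y (p * X i)) =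
        X i * (p - C (eval y p)) + C (eval y p) * (X i - C (y i)) := by
      simp; ring
    rw [this]
    exact Ideal.add_mem _ (Ideal.mul_mem_left _ _ hp)
      (Ideal.mul_mem_left _ _ (Ideal.subset_span ⟨i, rfl⟩))

/-- The top coefficient functional against the product of geometric sums evaluates at `y`. -/
theorem coeff_top {σ S : Type*} [Fintype σ] [DecidableEq σ] [CommRing S] (N : ℕ) (y : σ → S)
    (hy : ∀ i, y i ^ N = 0) (u : MvPolynomial σ S) :
    coeff (Finsupp.equivFunOnFinite.symm fun _ => N - 1)
      (u * ∏ i, ∑ a ∈ Finset.range N, X i ^ a * C (y i) ^ (N - 1 - a)) = eval y u := by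
  set t : σ →₀ ℕ := Finsupp.equivFunOnFinite.symm fun _ => N - 1 with ht
  set Q : MvPolynomial σ S := ∏ i, ∑ a ∈ Finset.range N, X i ^ a * C (y i) ^ (N - 1 - a) with hQ
  rcases Nat.eq_zero_or_pos N with hN | hN
  · by_cases hσ : Nonempty σ
    · obtain ⟨i⟩ := hσ
      have h1 : (1 : S) = 0 := by have := hy i; rwa [hN, pow_zero] at this
      have : Subsingleton S := subsingleton_of_zero_eq_one h1.symm
      exact Subsingleton.elim _ _
    · have hE : IsEmpty σ := not_nonempty_iff.1 hσ
      have h0 : t = 0 := Subsingleton.elim _ _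
      rw [hQ, Finset.univ_eq_empty, Finset.prod_empty, mul_one, h0]
      rw [MvPolynomial.eq_C_of_isEmpty u]
      simp
  have hqi : ∀ i, (∑ a ∈ Finset.range N, X i ^ a * C (y i) ^ (N - 1 - a)) * (X i - C (y i))
      = (X i ^ N : MvPolynomial σ S) := by
    intro i
    rw [(Commute.all (X i : MvPolynomial σ S) (C (y i))).geom_sum₂_mul, ← C_pow, hy i]
    simp
  have hJ : (u - C (eval y u)) * Q ∈
      Ideal.span ((fun k => (X k : MvPolynomial σ S) ^ N) '' Set.univ) := by
    have h1 : Ideal.span (Set.range fun k => (X k - C (y k) : MvPolynomial σ S)) ≤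
      (Ideal.span ((fun k => (X k : MvPolynomial σ S) ^ N) '' Set.univ)).colon {Q} := by
      rw [Ideal.span_le]
      rintro _ ⟨k, rfl⟩
      rw [SetLike.mem_coe, Submodule.mem_colon_singleton, smul_eq_mul, hQ,
        ← Finset.mul_prod_erase _ _ (Finset.mem_univ k), ← mul_assoc, mul_comm (X k - C (y k)),
        hqi k]
      exact Ideal.mul_mem_right _ _ (Ideal.subset_span ⟨k, trivial, rfl⟩)
    have := h1 (sub_eval_mem y u)
    rwa [Submodule.mem_colon_singleton, smul_eq_mul] at this
  rw [mem_powIdeal] at hJ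
  have h2 := hJ t (fun k _ => by simp [ht]; omega)
  rw [sub_mul, coeff_sub, coeff_C_mul, sub_eq_zero] at h2
  rw [h2]
  have h3 : coeff t Q = 1 := by
    rw [hQ, Finset.prod_univ_sum, coeff_sum]
    rw [Finset.sum_eq_single (fun _ => N - 1)]
    · rw [Finset.prod_mul_distrib]
      have : ∏ i : σ, (X i : MvPolynomial σ S) ^ (N - 1) = monomial t 1 := by
        rw [monomial_eq, Finsupp.prod_fintype _ _ (by simp)]
        simp [ht]
      rw [this]
      simp
    · intro b _ hb
      rw [Finset.prod_mul_distrib]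
      have : ∏ i : σ, (X i : MvPolynomial σ S) ^ (b i) =
          monomial (Finsupp.equivFunOnFinite.symm b) 1 := by
        rw [monomial_eq, Finsupp.prod_fintype _ _ (by simp)]
        simp
      rw [this]
      simp_rw [← C_pow]
      rw [← map_prod, mul_comm, coeff_C_mul, coeff_monomial, if_neg, mul_zero]
      intro h
      apply hb
      exact Finsupp.equivFunOnFinite.symm.injective h
    · intro h
      exfalso; apply h
      simp; omega
  rw [h3, mul_one]

theorem geom_mul {σ S : Type*} [CommRing S] (N : ℕ) (i : σ) (y : S) (hy : y ^ N = 0) :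
    (∑ a ∈ Finset.range N, X i ^ a * C y ^ (N - 1 - a)) * (X i - C y)
      = (X i ^ N : MvPolynomial σ S) := by
  rw [(Commute.all (X i : MvPolynomial σ S) (C y)).geom_sum₂_mul, ← C_pow, hy]
  simp

theorem wiebe_aux {σ K S : Type*} [Fintype σ] [DecidableEq σ] [Field K] [CommRing S]
    (f : K →+* S) (y : σ → S) (N : ℕ) (hN : 0 < N)
    (θ : σ → MvPolynomial σ K) (A : Matrix σ σ (MvPolynomial σ K))
    (hA : ∀ i, ∑ j, A i j * θ j = X i ^ N) (u : MvPolynomial σ K)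
    (hu : u * A.det ∈ Ideal.span ((fun k => (X k : MvPolynomial σ K) ^ N) '' Set.univ))
    (hθ0 : ∀ j, eval y (MvPolynomial.map f (θ j)) = 0) :
    eval y (MvPolynomial.map f u) = 0 := by
  let φ : MvPolynomial σ K →+* MvPolynomial σ S := MvPolynomial.map f
  have hy : ∀ i, y i ^ N = 0 := by
    intro i
    have h : eval y (MvPolynomial.map f (X i ^ N)) = y i ^ N := by simp
    rw [← h, ← hA i, map_sum, map_sum]
    exact Finset.sum_eq_zero fun j _ => by rw [map_mul, map_mul, hθ0, mul_zero]
  have hb : ∀ j, ∃ c : σ → MvPolynomial σ S, ∑ k, c k * (X k - C (y k)) = φ (θ j) := by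
    intro j
    have := sub_eval_mem y (φ (θ j))
    rw [hθ0, C_0, sub_zero] at this
    exact Ideal.mem_span_range_iff_exists_fun.1 this
  choose b hb using hb
  let M : Matrix σ σ (MvPolynomial σ S) := φ.mapMatrix A * Matrix.of b
  have hM : ∀ i, ∑ k, M i k * (X k - C (y k)) = X i ^ N := by
    intro i
    have : ∀ k, M i k * (X k - C (y k)) = ∑ j, φ (A i j) * (b j k * (X k - C (y k))) := by
      intro k
      simp only [M, Matrix.mul_apply, Finset.sum_mul, RingHom.mapMatrix_apply, Matrix.map_apply,
        Matrix.of_apply, mul_assoc]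
    simp_rw [this]
    rw [Finset.sum_comm]
    simp_rw [← Finset.mul_sum, hb, ← map_mul]
    rw [← map_sum, hA i]
    simp [φ]
  have hdet := det_congr N y hy M _ hM (fun i => geom_mul N i (y i) (hy i))
  have hφu : φ u * M.det ∈ Ideal.span ((fun k => (X k : MvPolynomial σ S) ^ N) '' Set.univ) := by
    have : M.det = φ A.det * (Matrix.of b).det := by
      simp only [M]
      rw [Matrix.det_mul, RingHom.map_det]
    rw [this, ← mul_assoc, ← map_mul]
    apply Ideal.mul_mem_right
    have h1 := Ideal.mem_map_of_mem φ hu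
    rw [Ideal.map_span, Set.image_image] at h1
    simpa [φ] using h1
  have h2 := Ideal.sub_mem _ hφu (Ideal.mul_mem_left _ (φ u) hdet)
  rw [← mul_sub, sub_sub_cancel] at h2
  rw [mem_powIdeal] at h2
  have h3 := h2 (Finsupp.equivFunOnFinite.symm fun _ => N - 1) (fun k _ => by simp; omega)
  rwa [coeff_top N y hy] at h3

theorem wiebe {σ K : Type*} [Fintype σ] [DecidableEq σ] [Field K] (N : ℕ) (hN : 0 < N)
    (θ : σ → MvPolynomial σ K) (A : Matrix σ σ (MvPolynomial σ K))
    (hA : ∀ i, ∑ j, A i j * θ j = X i ^ N) (u : MvPolynomial σ K)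
    (hu : u * A.det ∈ Ideal.span ((fun k => (X k : MvPolynomial σ K) ^ N) '' Set.univ)) :
    u ∈ Ideal.span (Set.range θ) := by
  set I := Ideal.span (Set.range θ) with hI
  have hev : ∀ p, eval (fun i => Ideal.Quotient.mk I (X i))
      (MvPolynomial.map ((Ideal.Quotient.mk I).comp C) p) = Ideal.Quotient.mk I p := by
    intro p
    have : (eval (fun i => Ideal.Quotient.mk I (X i))).comp
      (MvPolynomial.map ((Ideal.Quotient.mk I).comp C)) = Ideal.Quotient.mk I := by
      apply MvPolynomial.ringHom_ext
      · intro r; simp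
      · intro i; simp
    exact congrArg (fun f => f p) this
  have := wiebe_aux ((Ideal.Quotient.mk I).comp C) (fun i => Ideal.Quotient.mk I (X i)) N hN θ A hA
    u hu (fun j => by
      rw [hev]; exact Ideal.Quotient.eq_zero_iff_mem.2 (Ideal.subset_span ⟨j, rfl⟩))
  rw [hev] at this
  exact Ideal.Quotient.eq_zero_iff_mem.1 this

theorem hc_mul {σ K : Type*} [CommRing K] (a g : MvPolynomial σ K) (k e : ℕ)
    (hg : g.IsHomogeneous e) :
    homogeneousComponent (k + e) (a * g) = homogeneousComponent k a * g := by
  let _ := MvPolynomial.gradedAlgebra (σ := σ) (R := K)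
  have := DirectSum.coe_decompose_mul_add_of_right_mem (homogeneousSubmodule σ K) (i := k) (a := a)
    ((mem_homogeneousSubmodule e g).2 hg)
  have h2 : ∀ (p : MvPolynomial σ K) i,
    (DirectSum.decompose (homogeneousSubmodule σ K) p i : MvPolynomial σ K) =
      homogeneousComponent i p := fun p i => decomposition.decompose'_apply p i
  rwa [h2, h2] at this

theorem hc_mul_lt {σ K : Type*} [CommRing K] (a g : MvPolynomial σ K) (k e : ℕ)
    (hg : g.IsHomogeneous e) (h : k < e) :
    homogeneousComponent k (a * g) = 0 := by
  let _ := MvPolynomial.gradedAlgebra (σ := σ) (R := K)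
  have := DirectSum.coe_decompose_mul_of_right_mem_of_not_le (homogeneousSubmodule σ K) (n := k)
    (a := a) ((mem_homogeneousSubmodule e g).2 hg) (by omega)
  have h2 : ∀ (p : MvPolynomial σ K) i,
    (DirectSum.decompose (homogeneousSubmodule σ K) p i : MvPolynomial σ K) =
      homogeneousComponent i p := fun p i => decomposition.decompose'_apply p i
  rwa [h2] at this

/-- Ideals stable under taking homogeneous components. -/
def HomI {σ K : Type*} [CommRing K] (I : Ideal (MvPolynomial σ K)) : Prop :=
  ∀ p ∈ I, ∀ k, homogeneousComponent k p ∈ I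

theorem homI_span {σ K : Type*} [CommRing K] (s : Set (MvPolynomial σ K))
    (hs : ∀ g ∈ s, ∃ k, g.IsHomogeneous k) : HomI (Ideal.span s) := by
  let _ := MvPolynomial.gradedAlgebra (σ := σ) (R := K)
  have := Ideal.homogeneous_span (homogeneousSubmodule σ K) s (fun g hg => by
    obtain ⟨k, hk⟩ := hs g hg
    exact ⟨k, (mem_homogeneousSubmodule k g).2 hk⟩)
  intro p hp k
  exact homogeneousComponent_mem_of_mem this hp k

theorem frobenius {σ K : Type*} [Fintype σ] [Field K]
    (θ : σ → MvPolynomial σ K) (e : σ → ℕ) (hθ : ∀ j, (θ j).IsHomogeneous (e j))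
    (hr : ∀ i, X i ∈ (Ideal.span (Set.range θ)).radical) :
    ∃ τ : MvPolynomial σ K →ₗ[K] K, (∀ g ∈ Ideal.span (Set.range θ), τ g = 0) ∧
      (∀ u, (∀ v, τ (u * v) = 0) → u ∈ Ideal.span (Set.range θ)) ∧
      (∀ k v, v.IsHomogeneous k → k + Fintype.card σ ≠ ∑ j, e j → τ v = 0) := by
  have hr' : ∀ i, ∃ n, (X i : MvPolynomial σ K) ^ n ∈ Ideal.span (Set.range θ) := hr
  choose n hn using hr'
  set N := (∑ i, n i) + (∑ j, e j) + 1 with hN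
  have hnN : ∀ i, n i ≤ N := fun i => by
    have := Finset.single_le_sum (f := n) (fun _ _ => Nat.zero_le _) (Finset.mem_univ i)
    omega
  have heN : ∀ i, e i ≤ N := fun i => by
    have := Finset.single_le_sum (f := e) (fun _ _ => Nat.zero_le _) (Finset.mem_univ i)
    omega
  have hXN : ∀ i, ∃ c : σ → MvPolynomial σ K, (∀ j, (c j).IsHomogeneous (N - e j)) ∧
      ∑ j, c j * θ j = X i ^ N := by
    intro i
    have h1 := Ideal.pow_mem_of_pow_mem _ (hn i) (hnN i)
    obtain ⟨c, hc⟩ := Ideal.mem_span_range_iff_exists_fun.1 h1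
    refine ⟨fun j => homogeneousComponent (N - e j) (c j),
      fun j => homogeneousComponent_isHomogeneous _ _, ?_⟩
    have h2 := congrArg (homogeneousComponent N) hc
    rw [map_sum, homogeneousComponent_eq_self ] at h2
    · rw [← h2]
      refine Finset.sum_congr rfl fun j _ => ?_
      rw [← hc_mul _ _ _ _ (hθ j), Nat.sub_add_cancel (heN j)]
    · exact isHomogeneous_X_pow i N
  choose A hAh hA using hXN
  set D := (Matrix.of A).det with hD
  have hDh : D.IsHomogeneous (∑ j, (N - e j)) := by
    rw [hD, Matrix.det_apply]
    refine IsHomogeneous.sum _ _ _ fun s _ => ?_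
    have : (∏ i, Matrix.of A (s i) i).IsHomogeneous (∑ j, (N - e j)) :=
      IsHomogeneous.prod _ _ _ fun i _ => hAh _ _
    rcases Int.units_eq_one_or (Equiv.Perm.sign s) with h | h
    · rw [h, one_smul]; exact this
    · rw [h, Units.neg_smul, one_smul]; exact this.neg
  set t : σ →₀ ℕ := Finsupp.equivFunOnFinite.symm fun _ => N - 1 with ht
  refine ⟨(lcoeff K t) ∘ₗ (LinearMap.mulRight K D), ?_, ?_, ?_⟩
  · intro g hg
    have h1 : g * D ∈ Ideal.span ((fun k => (X k : MvPolynomial σ K) ^ N) '' Set.univ) := by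
      have h2 : Ideal.span (Set.range θ) ≤
          (Ideal.span ((fun k => (X k : MvPolynomial σ K) ^ N) '' Set.univ)).colon {D} := by
        rw [Ideal.span_le]
        rintro _ ⟨k, rfl⟩
        rw [SetLike.mem_coe, Submodule.mem_colon_singleton, smul_eq_mul]
        have h5 : D * θ k = ∑ j, (Matrix.of A).adjugate k j * ((Matrix.of A).mulVec θ) j := by
          have : (Matrix.of A).adjugate.mulVec ((Matrix.of A).mulVec θ) = D • θ := by
            rw [Matrix.mulVec_mulVec, Matrix.adjugate_mul, Matrix.smul_mulVec, Matrix.one_mulVec]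
          have := congrFun this k
          simp only [Pi.smul_apply, smul_eq_mul] at this
          rw [← this]; rfl
        rw [mul_comm, h5]
        refine Ideal.sum_mem _ fun j _ => Ideal.mul_mem_left _ _ ?_
        have : (Matrix.of A).mulVec θ j = X j ^ N := hA j
        rw [this]
        exact Ideal.subset_span ⟨j, trivial, rfl⟩
      have := h2 hg
      rwa [Submodule.mem_colon_singleton, smul_eq_mul] at this
    rw [mem_powIdeal] at h1
    exact h1 t (fun k _ => by simp [ht]; omega)
  · intro u hu
    refine wiebe N (by omega) θ (Matrix.of A) hA u ?_
    rw [mem_powIdeal]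
    intro a ha
    have h1 := hu (monomial (t - a) 1)
    simp only [LinearMap.comp_apply, LinearMap.mulRight_apply, lcoeff_apply] at h1
    rw [mul_right_comm] at h1
    have h2 : t = a + (t - a) := by
      rw [add_tsub_cancel_of_le]
      intro k
      have := ha k trivial
      simp [ht]; omega
    conv at h1 => 
      lhs
      rw [h2]
      rw [add_tsub_cancel_left]
    rwa [coeff_mul_monomial, mul_one] at h1
  · intro k v hv hk
    simp only [LinearMap.comp_apply, LinearMap.mulRight_apply, lcoeff_apply]
    refine (hv.mul hDh).coeff_eq_zero ?_
    intro h
    apply hk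
    have h1 : t.degree = Fintype.card σ * (N - 1) := by
      rw [Finsupp.degree_eq_sum]; simp [ht]
    have h2 : ∑ j, (N - e j) + ∑ j, e j = Fintype.card σ * N := by
      rw [← Finset.sum_add_distrib, Finset.sum_congr rfl fun j _ => Nat.sub_add_cancel (heN j)]
      simp
    have h3 : Fintype.card σ * (N - 1) + Fintype.card σ = Fintype.card σ * N := by
      rw [← Nat.mul_succ]; congr 1
    omega

theorem mem_of_degree_gt {σ K : Type*} [Fintype σ] [Field K]
    (θ : σ → MvPolynomial σ K) (e : σ → ℕ) (hθ : ∀ j, (θ j).IsHomogeneous (e j))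
    (hr : ∀ i, X i ∈ (Ideal.span (Set.range θ)).radical) (k : ℕ) (v : MvPolynomial σ K)
    (hv : v.IsHomogeneous k) (hk : ∑ j, e j < k + Fintype.card σ) :
    v ∈ Ideal.span (Set.range θ) := by
  obtain ⟨τ, h1, h2, h3⟩ := frobenius θ e hθ hr
  refine h2 v fun w => ?_
  rw [← sum_homogeneousComponent w, Finset.mul_sum, map_sum]
  refine Finset.sum_eq_zero fun j _ => ?_
  exact h3 _ _ (hv.mul (homogeneousComponent_isHomogeneous j w)) (by omega)

/-- Degreewise form of nondegeneracy. -/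
theorem nondeg {σ K : Type*} [Fintype σ] [Field K]
    (τ : MvPolynomial σ K →ₗ[K] K) (I : Ideal (MvPolynomial σ K)) (E : ℕ)
    (h2 : ∀ u, (∀ v, τ (u * v) = 0) → u ∈ I)
    (h3 : ∀ k v, v.IsHomogeneous k → k + Fintype.card σ ≠ E → τ v = 0)
    (i : ℕ) (u : MvPolynomial σ K) (hu : u.IsHomogeneous i)
    (h : ∀ j v, v.IsHomogeneous j → i + j + Fintype.card σ = E → τ (u * v) = 0) : u ∈ I := by
  refine h2 u fun w => ?_
  rw [← sum_homogeneousComponent w, Finset.mul_sum, map_sum]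
  refine Finset.sum_eq_zero fun j _ => ?_
  by_cases hj : i + j + Fintype.card σ = E
  · exact h j _ (homogeneousComponent_isHomogeneous j w) hj
  · exact h3 _ _ (hu.mul (homogeneousComponent_isHomogeneous j w)) hj

theorem radical_pow {σ K : Type*} [Field K]
    (θ : σ → MvPolynomial σ K) (a : σ → ℕ)
    (hr : ∀ i, X i ∈ (Ideal.span (Set.range θ)).radical) (i : σ) :
    X i ∈ (Ideal.span (Set.range fun j => θ j ^ a j)).radical := by
  have : Ideal.span (Set.range θ) ≤ (Ideal.span (Set.range fun j => θ j ^ a j)).radical := by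
    rw [Ideal.span_le]
    rintro _ ⟨j, rfl⟩
    exact ⟨a j, Ideal.subset_span ⟨j, rfl⟩⟩
  exact (Ideal.radical_le_radical_iff.2 this) (hr i)

theorem regular {σ K : Type*} [Fintype σ] [Field K]
    (θ : σ → MvPolynomial σ K) (e : σ → ℕ) (hθ : ∀ j, (θ j).IsHomogeneous (e j))
    (he : ∀ j, 0 < e j)
    (hr : ∀ i, X i ∈ (Ideal.span (Set.range θ)).radical) (I : Finset σ) (k : σ) (hk : k ∉ I)
    (i : ℕ) (u : MvPolynomial σ K) (hu : u.IsHomogeneous i)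
    (hku : θ k * u ∈ Ideal.span (θ '' I)) : u ∈ Ideal.span (θ '' I) := by
  set N := i + 2 with hN
  let a : σ → ℕ := fun j => if j ∈ I then 1 else N
  let b : σ → ℕ := fun j => if j ∈ insert k I then 1 else N
  have hI : Ideal.span (θ '' I) ≤ Ideal.span (Set.range fun j => θ j ^ a j) := by
    rw [Ideal.span_le]
    rintro _ ⟨j, hj, rfl⟩
    refine Ideal.subset_span ⟨j, ?_⟩
    have : j ∈ I := hj
    simp [a, this]
  have hpow : ∀ (c : σ → ℕ) j, (θ j ^ c j).IsHomogeneous (e j * c j) := fun c j => (hθ j).pow _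
  have hmem : u ∈ Ideal.span (Set.range fun j => θ j ^ a j) := by
    obtain ⟨τ, h1, h2, h3⟩ := frobenius (fun j => θ j ^ a j) _ (hpow a) (radical_pow θ a hr)
    refine nondeg τ _ _ h2 h3 i u hu fun j v hv hj => h1 _ ?_
    have hvm : v ∈ Ideal.span (Set.range fun j => θ j ^ b j) := by
      refine mem_of_degree_gt (fun j => θ j ^ b j) _ (hpow b) (radical_pow θ b hr) j v hv ?_
      have s1 : ∑ j, e j * a j = e k * N + ∑ j ∈ Finset.univ.erase k, e j * a j := by
        rw [← Finset.add_sum_erase _ _ (Finset.mem_univ k)]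
        simp [a, hk]
      have s2 : ∑ j, e j * b j = e k + ∑ j ∈ Finset.univ.erase k, e j * a j := by
        rw [← Finset.add_sum_erase _ _ (Finset.mem_univ k)]
        congr 1
        · simp [b]
        · refine Finset.sum_congr rfl fun j hj => ?_
          have : j ≠ k := Finset.ne_of_mem_erase hj
          simp [a, b, this]
      have s3 : e k + (i + 1) ≤ e k * N := by
        have := he k
        rw [hN]; nlinarith
      omega
    obtain ⟨c, rfl⟩ := Ideal.mem_span_range_iff_exists_fun.1 hvm
    rw [Finset.mul_sum]
    refine Ideal.sum_mem _ fun l _ => ?_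
    by_cases hl : l = k
    · subst hl
      have : u * (c l * θ l ^ b l) = c l * (θ l * u) := by simp [b]; ring
      rw [this]
      exact Ideal.mul_mem_left _ _ (hI hku)
    · have : b l = a l := by simp [a, b, hl]
      rw [this]
      exact Ideal.mul_mem_left _ _ (Ideal.mul_mem_left _ _ (Ideal.subset_span ⟨l, rfl⟩))
  obtain ⟨c, hc⟩ := Ideal.mem_span_range_iff_exists_fun.1 hmem
  rw [← homogeneousComponent_eq_self hu, ← hc, map_sum]
  refine Ideal.sum_mem _ fun l _ => ?_
  by_cases hl : l ∈ I
  · have : a l = 1 := by simp [a, hl]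
    rw [this, pow_one]
    have hl' : θ l ∈ Ideal.span (θ '' (I : Set σ)) := Ideal.subset_span ⟨l, hl, rfl⟩
    refine homI_span _ ?_ _ (Ideal.mul_mem_left _ _ hl') _
    rintro _ ⟨j, _, rfl⟩
    exact ⟨_, hθ j⟩
  · rw [hc_mul_lt _ _ _ _ (hpow a l)]
    · exact Ideal.zero_mem _
    · have := he l
      simp only [a, hl, if_false]
      nlinarith

/-! Hilbert functions -/

/-- Hilbert function of the quotient by an ideal. -/
noncomputable def HF {σ K : Type*} [Field K] (I : Ideal (MvPolynomial σ K)) (i : ℕ) : ℕ :=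
  Module.finrank K ((homogeneousSubmodule σ K i).map (I.restrictScalars K).mkQ)

instance finHom {σ K : Type*} [Finite σ] [Field K] (i : ℕ) :
    FiniteDimensional K (homogeneousSubmodule σ K i) :=
  Module.Finite.iff_fg.2 (homogeneousSubmodule_fg σ K i)

theorem rank_null {K V W : Type*} [Field K] [AddCommGroup V] [Module K V] [AddCommGroup W]
    [Module K W] (L : V →ₗ[K] W) (P : Submodule K V) [FiniteDimensional K P] :
    Module.finrank K (P.map L) + Module.finrank K (P ⊓ LinearMap.ker L : Submodule K V) =
      Module.finrank K P := by
  have h := LinearMap.finrank_range_add_finrank_ker (L.domRestrict P)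
  have h1 : LinearMap.range (L.domRestrict P) = P.map L := by
    rw [LinearMap.range_domRestrict]
  have h2 : (LinearMap.ker (L.domRestrict P)).map P.subtype = P ⊓ LinearMap.ker L := by
    ext x
    simp [and_comm]
  rw [h1] at h
  rw [← h, ← h2]
  congr 1
  exact (Submodule.equivMapOfInjective P.subtype P.injective_subtype _).finrank_eq.symm

theorem HF_add {σ K : Type*} [Finite σ] [Field K] (I : Ideal (MvPolynomial σ K)) (i : ℕ) :
    HF I i + Module.finrank K (homogeneousSubmodule σ K i ⊓ I.restrictScalars K :
      Submodule K (MvPolynomial σ K)) = Module.finrank K (homogeneousSubmodule σ K i) := by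
  have := rank_null (I.restrictScalars K).mkQ (homogeneousSubmodule σ K i)
  rwa [Submodule.ker_mkQ] at this

theorem HF_mono {σ K : Type*} [Finite σ] [Field K] (I J : Ideal (MvPolynomial σ K)) (h : I ≤ J)
    (i : ℕ) : HF J i ≤ HF I i := by
  have h1 := HF_add I i
  have h2 := HF_add J i
  have : FiniteDimensional K (homogeneousSubmodule σ K i ⊓ J.restrictScalars K :
      Submodule K (MvPolynomial σ K)) := Submodule.finiteDimensional_of_le inf_le_left
  have h3 : Module.finrank K (homogeneousSubmodule σ K i ⊓ I.restrictScalars K :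
      Submodule K (MvPolynomial σ K)) ≤ Module.finrank K
      (homogeneousSubmodule σ K i ⊓ J.restrictScalars K : Submodule K (MvPolynomial σ K)) :=
    Submodule.finrank_mono (inf_le_inf_left _ h)
  omega

theorem mem_of_HF_eq {σ K : Type*} [Finite σ] [Field K] (I J : Ideal (MvPolynomial σ K))
    (h : I ≤ J) (i : ℕ) (hIJ : HF I i = HF J i) (u : MvPolynomial σ K) (hu : u.IsHomogeneous i)
    (huJ : u ∈ J) : u ∈ I := by
  have h1 := HF_add I i
  have h2 := HF_add J i
  have : FiniteDimensional K (homogeneousSubmodule σ K i ⊓ J.restrictScalars K :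
      Submodule K (MvPolynomial σ K)) := Submodule.finiteDimensional_of_le inf_le_left
  have h3 : (homogeneousSubmodule σ K i ⊓ I.restrictScalars K :
      Submodule K (MvPolynomial σ K)) = 
      (homogeneousSubmodule σ K i ⊓ J.restrictScalars K : Submodule K (MvPolynomial σ K)) :=
    Submodule.eq_of_le_of_finrank_eq (inf_le_inf_left _ h) (by omega)
  have : u ∈ (homogeneousSubmodule σ K i ⊓ J.restrictScalars K :
    Submodule K (MvPolynomial σ K)) := ⟨hu, huJ⟩
  rw [← h3] at this
  exact this.2

theorem HF_of_ge {σ K : Type*} [Finite σ] [Field K] (I : Ideal (MvPolynomial σ K)) (i : ℕ)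
    (h : ∀ u : MvPolynomial σ K, u.IsHomogeneous i → u ∈ I) : HF I i = 0 := by
  have h1 := HF_add I i
  have : (homogeneousSubmodule σ K i ⊓ I.restrictScalars K :
      Submodule K (MvPolynomial σ K)) = homogeneousSubmodule σ K i :=
    inf_eq_left.2 fun u hu => h u hu
  rw [this] at h1
  omega

theorem mem_sup_comp {σ K : Type*} [Field K] (I : Ideal (MvPolynomial σ K))
    (hI : HomI I) (g : MvPolynomial σ K) (u : MvPolynomial σ K) 
    (hu : u ∈ I ⊔ Ideal.span {g}) : ∃ a ∈ I, ∃ b, u = a + b * g := by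
  obtain ⟨a, ha, c, hc, rfl⟩ := Submodule.mem_sup.1 hu
  obtain ⟨b, rfl⟩ := Ideal.mem_span_singleton'.1 hc
  exact ⟨a, ha, b, rfl⟩

theorem HF_step {σ K : Type*} [Finite σ] [Field K] (I : Ideal (MvPolynomial σ K)) (hI : HomI I)
    (g : MvPolynomial σ K) (e : ℕ) (hg : g.IsHomogeneous e)
    (hreg : ∀ i u, u.IsHomogeneous i → g * u ∈ I → u ∈ I) (i : ℕ) :
    HF (I ⊔ Ideal.span {g}) (i + e) + HF I i = HF I (i + e) := by
  set I' := I ⊔ Ideal.span {g} with hI'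
  have h1 := HF_add I (i + e)
  have h2 := HF_add I' (i + e)
  have h1i := HF_add I i
  have hle : I ≤ I' := le_sup_left
  have : FiniteDimensional K (homogeneousSubmodule σ K (i + e) ⊓ I'.restrictScalars K :
      Submodule K (MvPolynomial σ K)) := Submodule.finiteDimensional_of_le inf_le_left
  have h3 := rank_null (I.restrictScalars K).mkQ
    (homogeneousSubmodule σ K (i + e) ⊓ I'.restrictScalars K)
  have h4 := rank_null ((I.restrictScalars K).mkQ ∘ₗ LinearMap.mulLeft K g)
    (homogeneousSubmodule σ K i)
  have e3 : (homogeneousSubmodule σ K (i + e) ⊓ I'.restrictScalars K ⊓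
      LinearMap.ker (I.restrictScalars K).mkQ) = 
      homogeneousSubmodule σ K (i + e) ⊓ I.restrictScalars K := by
    rw [Submodule.ker_mkQ, inf_assoc]
    congr 1
    exact inf_eq_right.2 hle
  have e4 : (homogeneousSubmodule σ K i ⊓
      LinearMap.ker ((I.restrictScalars K).mkQ ∘ₗ LinearMap.mulLeft K g)) = 
      homogeneousSubmodule σ K i ⊓ I.restrictScalars K := by
    ext u
    simp only [Submodule.mem_inf, LinearMap.mem_ker, LinearMap.comp_apply, LinearMap.mulLeft_apply,
      Submodule.mkQ_apply, Submodule.Quotient.mk_eq_zero, Submodule.restrictScalars_mem]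
    constructor
    · rintro ⟨hu, h⟩; exact ⟨hu, hreg i u hu h⟩
    · rintro ⟨hu, h⟩; exact ⟨hu, Ideal.mul_mem_left _ _ h⟩
  have e5 : (homogeneousSubmodule σ K (i + e) ⊓ I'.restrictScalars K).map (I.restrictScalars K).mkQ
      = (homogeneousSubmodule σ K i).map ((I.restrictScalars K).mkQ ∘ₗ LinearMap.mulLeft K g) := by
    apply le_antisymm
    · rintro _ ⟨u, ⟨hu, huI⟩, rfl⟩
      obtain ⟨a, ha, b, hab⟩ := mem_sup_comp I hI g u huI
      refine ⟨homogeneousComponent i b, homogeneousComponent_mem _ _, ?_⟩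
      simp only [LinearMap.comp_apply, LinearMap.mulLeft_apply, Submodule.mkQ_apply]
      rw [eq_comm, Submodule.Quotient.eq]
      have hu' : homogeneousComponent (i + e) u = u := homogeneousComponent_eq_self hu
      rw [← hu', hab, map_add, hc_mul _ _ _ _ hg, mul_comm, add_sub_cancel_right]
      exact hI a ha _
    · rintro _ ⟨u, hu, rfl⟩
      refine ⟨g * u, ⟨?_, ?_⟩, rfl⟩
      · rw [SetLike.mem_coe, mem_homogeneousSubmodule, add_comm]
        exact hg.mul hu
      · exact Ideal.mul_mem_right _ _ ((le_sup_right : Ideal.span {g} ≤ I')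
          (Ideal.mem_span_singleton_self g))
  rw [e3, e5] at h3
  rw [e4] at h4
  omega

theorem HF_step_lt {σ K : Type*} [Finite σ] [Field K] (I : Ideal (MvPolynomial σ K)) (hI : HomI I)
    (g : MvPolynomial σ K) (e : ℕ) (hg : g.IsHomogeneous e) (i : ℕ) (hi : i < e) :
    HF (I ⊔ Ideal.span {g}) i = HF I i := by
  set I' := I ⊔ Ideal.span {g} with hI'
  have h1 := HF_add I i
  have h2 := HF_add I' i
  have : (homogeneousSubmodule σ K i ⊓ I'.restrictScalars K) = 
      homogeneousSubmodule σ K i ⊓ I.restrictScalars K := by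
    apply le_antisymm
    · rintro u ⟨hu, huI⟩
      refine ⟨hu, ?_⟩
      obtain ⟨a, ha, b, hab⟩ := mem_sup_comp I hI g u huI
      have hu' : homogeneousComponent i u = u := homogeneousComponent_eq_self hu
      rw [← hu', hab, map_add, hc_mul_lt _ _ _ _ hg hi, add_zero]
      exact hI a ha _
    · exact inf_le_inf_left _ (le_sup_left : I ≤ I')
  rw [this] at h2
  omega

/-- Hilbert series. -/
noncomputable def HS {σ K : Type*} [Field K] (I : Ideal (MvPolynomial σ K)) : PowerSeries ℤ :=
  PowerSeries.mk fun i => (HF I i : ℤ)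

theorem HS_step {σ K : Type*} [Finite σ] [Field K] (I : Ideal (MvPolynomial σ K)) (hI : HomI I)
    (g : MvPolynomial σ K) (e : ℕ) (hg : g.IsHomogeneous e)
    (hreg : ∀ i u, u.IsHomogeneous i → g * u ∈ I → u ∈ I) :
    HS (I ⊔ Ideal.span {g}) = (1 - PowerSeries.X ^ e) * HS I := by
  ext i
  rw [sub_mul, one_mul, map_sub, PowerSeries.coeff_X_pow_mul']
  simp only [HS, PowerSeries.coeff_mk]
  split_ifs with h
  · have := HF_step I hI g e hg hreg (i - e)
    rw [Nat.sub_add_cancel h] at this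
    omega
  · rw [HF_step_lt I hI g e hg i (by omega)]
    simp

theorem HS_prod {σ K : Type*} [Fintype σ] [Field K]
    (θ : σ → MvPolynomial σ K) (e : σ → ℕ) (hθ : ∀ j, (θ j).IsHomogeneous (e j))
    (he : ∀ j, 0 < e j)
    (hr : ∀ i, X i ∈ (Ideal.span (Set.range θ)).radical) (s : Finset σ) :
    HS (Ideal.span (θ '' s)) = (∏ j ∈ s, (1 - PowerSeries.X ^ e j)) *
      HS (⊥ : Ideal (MvPolynomial σ K)) := by
  induction s using Finset.induction_on with
  | empty => simp
  | insert k s hk ih =>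
    rw [Finset.prod_insert hk, mul_assoc, ← ih]
    rw [← HS_step _ (homI_span _ (by rintro _ ⟨j, _, rfl⟩; exact ⟨_, hθ j⟩)) (θ k) (e k) (hθ k)
      (fun i u hu => regular θ e hθ he hr s k hk i u hu)]
    rw [← Ideal.span_union, Finset.coe_insert, Set.image_insert_eq, Set.union_singleton]

theorem HS_X {σ K : Type*} [Fintype σ] [Field K] :
    HS (Ideal.span (Set.range (X : σ → MvPolynomial σ K))) = 1 := by
  ext i
  rw [PowerSeries.coeff_one]
  simp only [HS, PowerSeries.coeff_mk]
  have hmem : ∀ u : MvPolynomial σ K, u ∈ Ideal.span (Set.range (X : σ → MvPolynomial σ K)) ↔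
      coeff 0 u = 0 := by
    intro u
    rw [← Set.image_univ, mem_ideal_span_X_image]
    constructor
    · intro h
      by_contra hc
      obtain ⟨i, _, hi⟩ := h 0 (mem_support_iff.2 hc)
      simp at hi
    · intro h m hm
      by_contra hc
      push Not at hc
      have : m = 0 := by ext i; simpa using hc i trivial
      subst this
      exact (mem_support_iff.1 hm) h
  split_ifs with h
  · subst h
    have h1 := HF_add (Ideal.span (Set.range (X : σ → MvPolynomial σ K))) 0
    have h2 : (homogeneousSubmodule σ K 0 ⊓
        (Ideal.span (Set.range (X : σ → MvPolynomial σ K))).restrictScalars K) = ⊥ := by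
      rw [eq_bot_iff]
      rintro u ⟨hu, huI⟩
      have h0 := (hmem u).1 huI
      have hu' : homogeneousComponent 0 u = u := homogeneousComponent_eq_self hu
      rw [homogeneousComponent_zero, h0, C_0] at hu'
      simp [← hu']
    rw [h2, finrank_bot, homogeneousSubmodule_zero, Submodule.one_eq_span,
      finrank_span_singleton one_ne_zero] at h1
    simp at h1 ⊢
    exact h1
  · rw [HF_of_ge]
    · simp
    intro u hu
    rw [hmem]
    exact hu.coeff_eq_zero (by simpa using fun h' => h h'.symm)

theorem HS_eq {σ K : Type*} [Fintype σ] [Field K]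
    (θ : σ → MvPolynomial σ K) (e : σ → ℕ) (hθ : ∀ j, (θ j).IsHomogeneous (e j))
    (he : ∀ j, 0 < e j)
    (hr : ∀ i, X i ∈ (Ideal.span (Set.range θ)).radical) :
    HS (Ideal.span (Set.range θ)) =
      ((∏ j, ∑ a ∈ Finset.range (e j), Polynomial.X ^ a : Polynomial ℤ) : PowerSeries ℤ) := by
  have h1 := HS_prod θ e hθ he hr Finset.univ
  have h2 := HS_prod (X : σ → MvPolynomial σ K) (fun _ => 1) (fun j => isHomogeneous_X K j)
    (fun _ => one_pos) (fun i => Ideal.le_radical (Ideal.subset_span ⟨i, rfl⟩)) Finset.univ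
  rw [Finset.coe_univ, Set.image_univ] at h1 h2
  rw [HS_X] at h2
  have hne : (∏ j : σ, (1 - (PowerSeries.X : PowerSeries ℤ) ^ 1)) ≠ 0 :=
    left_ne_zero_of_mul (h2 ▸ one_ne_zero)
  apply mul_left_cancel₀ hne
  rw [h1, mul_left_comm, ← h2, mul_one]
  rw [← Polynomial.coe_one, ← Polynomial.coe_X]
  simp_rw [← Polynomial.coe_pow, ← Polynomial.coe_sub]
  have hc : ∀ F : σ → Polynomial ℤ, ∏ j, (F j : PowerSeries ℤ) = ((∏ j, F j : Polynomial ℤ) :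
      PowerSeries ℤ) := fun F => (map_prod (Polynomial.coeToPowerSeries.ringHom (R := ℤ)) F _).symm
  rw [hc, hc, ← Polynomial.coe_mul, ← Finset.prod_mul_distrib]
  congr 2
  ext1 j
  rw [pow_one, mul_comm, geom_sum_mul_neg]

theorem sum_HF {σ K : Type*} [Fintype σ] [Field K]
    (θ : σ → MvPolynomial σ K) (e : σ → ℕ) (hθ : ∀ j, (θ j).IsHomogeneous (e j))
    (he : ∀ j, 0 < e j)
    (hr : ∀ i, X i ∈ (Ideal.span (Set.range θ)).radical) :
    ∃ M₀, ∀ M, M₀ ≤ M → ∑ i ∈ Finset.range M, HF (Ideal.span (Set.range θ)) i = ∏ j, e j := by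
  set G : Polynomial ℤ := ∏ j, ∑ a ∈ Finset.range (e j), Polynomial.X ^ a with hG
  have h := HS_eq θ e hθ he hr
  refine ⟨G.natDegree + 1, fun M hM => ?_⟩
  have h1 : G.eval 1 = ∏ j, (e j : ℤ) := by
    rw [hG, Polynomial.eval_prod]
    refine Finset.prod_congr rfl fun j _ => ?_
    simp [Polynomial.eval_finsetSum]
  rw [Polynomial.eval_eq_sum_range' (n := M) (by omega)] at h1
  have h2 : ∀ i, G.coeff i = (HF (Ideal.span (Set.range θ)) i : ℤ) := by
    intro i
    have := congrArg (PowerSeries.coeff i) h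
    rw [Polynomial.coeff_coe] at this
    rw [← this]
    simp [HS]
  simp only [h2, one_pow, mul_one] at h1
  exact_mod_cast h1

theorem evalAt_eq {n : ℕ} (v : Fin (n + 1) → ℂ) (p : MvPolynomial (Fin (n + 1)) ℂ) :
    evalAt v p = MvPolynomial.eval v p := by
  simp [evalAt, MvPolynomial.aeval_eq_eval]

/-- The linear form attached to a dual vector. -/
noncomputable def lin {n : ℕ} (φ : Module.Dual ℂ (Fin (n + 1) → ℂ)) :
    MvPolynomial (Fin (n + 1)) ℂ := ∑ i, C (φ (Pi.single i 1)) * X i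

theorem lin_hom {n : ℕ} (φ : Module.Dual ℂ (Fin (n + 1) → ℂ)) : (lin φ).IsHomogeneous 1 := by
  refine IsHomogeneous.sum _ _ _ fun i _ => ?_
  simpa using (isHomogeneous_C _ _).mul (isHomogeneous_X ℂ i)

theorem eval_lin {n : ℕ} (φ : Module.Dual ℂ (Fin (n + 1) → ℂ)) (v : Fin (n + 1) → ℂ) :
    MvPolynomial.eval v (lin φ) = φ v := by
  conv_rhs => rw [← Finset.univ_sum_single v, map_sum]
  rw [lin, map_sum]
  refine Finset.sum_congr rfl fun i _ => ?_
  have : (Pi.single i (v i) : Fin (n + 1) → ℂ) = v i • Pi.single i 1 := by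
    rw [← Pi.single_smul]; simp
  rw [this, map_smul]
  simp [mul_comm]

/-- The homogeneous ideal of a finite set of points. -/
noncomputable def IY {n : ℕ} (Y : Finset (Pn n)) : Ideal (MvPolynomial (Fin (n + 1)) ℂ) :=
  Ideal.span {g | (∃ k, g.IsHomogeneous k) ∧ ∀ y ∈ Y, MvPolynomial.eval y.rep g = 0}

theorem IY_hom {n : ℕ} (Y : Finset (Pn n)) : HomI (IY Y) := homI_span _ fun _ hg => hg.1

theorem eval_IY {n : ℕ} (Y : Finset (Pn n)) (g : MvPolynomial (Fin (n + 1)) ℂ) (hg : g ∈ IY Y)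
    (y : Pn n) (hy : y ∈ Y) : MvPolynomial.eval y.rep g = 0 := by
  have : IY Y ≤ RingHom.ker (MvPolynomial.eval y.rep) :=
    Ideal.span_le.2 fun g hg => hg.2 y hy
  exact this hg

theorem mem_IY {n : ℕ} (Y : Finset (Pn n)) (g : MvPolynomial (Fin (n + 1)) ℂ) (k : ℕ)
    (hk : g.IsHomogeneous k) : g ∈ IY Y ↔ ∀ y ∈ Y, MvPolynomial.eval y.rep g = 0 :=
  ⟨fun h y hy => eval_IY Y g h y hy, fun h => Ideal.subset_span ⟨⟨k, hk⟩, h⟩⟩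

theorem hilb_eq {n : ℕ} (Y : Finset (Pn n)) (i : ℕ) : hilb Y i = HF (IY Y) i := by
  have h1 := HF_add (IY Y) i
  have h2 := rank_null (LinearMap.pi fun z : Y => evalAt (z : Pn n).rep) (Rdeg n i)
  have h3 : hilb Y i = Module.finrank ℂ
      ((Rdeg n i).map (LinearMap.pi fun z : Y => evalAt (z : Pn n).rep)) := by
    rw [hilb, evalMap, LinearMap.range_comp, Submodule.range_subtype]
  have h4 : (Rdeg n i ⊓ LinearMap.ker (LinearMap.pi fun z : Y => evalAt (z : Pn n).rep)) =
      Rdeg n i ⊓ (IY Y).restrictScalars ℂ := by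
    ext u
    simp only [Submodule.mem_inf, LinearMap.mem_ker, Submodule.restrictScalars_mem]
    refine and_congr_right fun hu => ?_
    rw [mem_IY Y u i hu]
    simp [funext_iff, evalAt_eq]
  rw [h4] at h2
  change _ + Module.finrank ℂ (homogeneousSubmodule (Fin (n + 1)) ℂ i ⊓
    (IY Y).restrictScalars ℂ : Submodule ℂ (MvPolynomial (Fin (n + 1)) ℂ)) =
    Module.finrank ℂ (homogeneousSubmodule (Fin (n + 1)) ℂ i) at h2
  omega

theorem hilb_le {n : ℕ} (Y : Finset (Pn n)) (i : ℕ) : hilb Y i ≤ Y.card := by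
  refine (Submodule.finrank_le _).trans ?_
  simp

theorem Dh_eq {n : ℕ} (Y : Finset (Pn n)) (l : MvPolynomial (Fin (n + 1)) ℂ)
    (hl : l.IsHomogeneous 1) (hne : ∀ y ∈ Y, MvPolynomial.eval y.rep l ≠ 0) (i : ℕ) :
    Dh Y i = HF (IY Y ⊔ Ideal.span {l}) i := by
  cases i with
  | zero => rw [Dh, hilb_eq, HF_step_lt _ (IY_hom Y) l 1 hl 0 one_pos]
  | succ i =>
    have := HF_step _ (IY_hom Y) l 1 hl (fun k u hu h => by
      rw [mem_IY Y u k hu]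
      intro y hy
      have := eval_IY Y _ h y hy
      rw [map_mul] at this
      exact (mul_eq_zero.1 this).resolve_left (hne y hy)) i
    rw [Dh, hilb_eq, hilb_eq]
    omega

theorem sum_Dh {n : ℕ} (Y : Finset (Pn n)) (l : MvPolynomial (Fin (n + 1)) ℂ)
    (hl : l.IsHomogeneous 1) (hne : ∀ y ∈ Y, MvPolynomial.eval y.rep l ≠ 0) (M : ℕ) :
    ∑ i ∈ Finset.range (M + 1), Dh Y i = hilb Y M := by
  induction M with
  | zero => simp [Dh]
  | succ M ih =>
    rw [Finset.sum_range_succ, ih, Dh]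
    have := HF_step _ (IY_hom Y) l 1 hl (fun k u hu h => by
      rw [mem_IY Y u k hu]
      intro y hy
      have := eval_IY Y _ h y hy
      rw [map_mul] at this
      exact (mul_eq_zero.1 this).resolve_left (hne y hy)) M
    rw [hilb_eq, hilb_eq]
    omega

theorem exists_sep {n : ℕ} (z w : Pn n) (h : w ≠ z) : ∃ g : MvPolynomial (Fin (n + 1)) ℂ,
    g.IsHomogeneous 1 ∧ MvPolynomial.eval w.rep g = 0 ∧ MvPolynomial.eval z.rep g ≠ 0 := by
  have hn : z.rep ∉ Submodule.span ℂ {w.rep} := by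
    intro hm
    obtain ⟨c, hc⟩ := Submodule.mem_span_singleton.1 hm
    apply h
    rw [← w.mk_rep, ← z.mk_rep, eq_comm, Projectivization.mk_eq_mk_iff']
    exact ⟨c, hc⟩
  obtain ⟨φ, h1, h2⟩ := Submodule.exists_le_ker_of_notMem hn
  refine ⟨lin φ, lin_hom φ, ?_, ?_⟩
  · rw [eval_lin]
    exact h2 (Submodule.mem_span_singleton_self _)
  · rwa [eval_lin]

theorem hilb_large {n : ℕ} (Y : Finset (Pn n)) (l : MvPolynomial (Fin (n + 1)) ℂ)
    (hl : l.IsHomogeneous 1) (hne : ∀ y ∈ Y, MvPolynomial.eval y.rep l ≠ 0) (M : ℕ)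
    (hM : Y.card ≤ M) : hilb Y M = Y.card := by
  have htop : LinearMap.range (evalMap Y M) = ⊤ := by
    rw [eq_top_iff, ← (Pi.basisFun ℂ Y).span_eq, Submodule.span_le]
    rintro _ ⟨z, rfl⟩
    have hs : ∀ w : Pn n, ∃ g : MvPolynomial (Fin (n + 1)) ℂ, g.IsHomogeneous 1 ∧
        (w ≠ z → MvPolynomial.eval w.rep g = 0 ∧ MvPolynomial.eval (z : Pn n).rep g ≠ 0) := by
      intro w
      by_cases h : w = z
      · exact ⟨0, isHomogeneous_zero _ _ _, fun h' => absurd h h'⟩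
      · obtain ⟨g, h1, h2⟩ := exists_sep z w h
        exact ⟨g, h1, fun _ => h2⟩
    choose g hg1 hg2 using hs
    set p := (∏ w ∈ Y.erase z, g w) * l ^ (M - (Y.erase z).card) with hp
    have hph : p.IsHomogeneous M := by
      have h1 := IsHomogeneous.prod (Y.erase z) g (fun _ => 1) fun w _ => hg1 w
      have h2 := h1.mul (hl.pow (M - (Y.erase z).card))
      have h3 : (Y.erase z).card ≤ Y.card := Finset.card_le_card (Finset.erase_subset _ _)
      convert h2 using 1
      simp
      omega
    have hpz : MvPolynomial.eval (z : Pn n).rep p ≠ 0 := by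
      rw [hp, map_mul, map_prod, map_pow]
      refine mul_ne_zero (Finset.prod_ne_zero_iff.2 fun w hw => ?_) (pow_ne_zero _ (hne z z.2))
      exact (hg2 w (Finset.ne_of_mem_erase hw)).2
    refine ⟨(MvPolynomial.eval (z : Pn n).rep p)⁻¹ • ⟨p, hph⟩, ?_⟩
    rw [map_smul]
    ext w
    simp only [Pi.smul_apply, evalMap, LinearMap.comp_apply, LinearMap.pi_apply, evalAt_eq,
      Submodule.subtype_apply, smul_eq_mul, Pi.basisFun_apply]
    by_cases hw : w = z
    · subst hw
      rw [Pi.single_eq_same, inv_mul_cancel₀ hpz]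
    · rw [Pi.single_eq_of_ne hw]
      have hw' : (w : Pn n) ≠ z := fun h => hw (Subtype.ext h)
      have : MvPolynomial.eval (w : Pn n).rep p = 0 := by
        rw [hp, map_mul, map_prod, Finset.prod_eq_zero (i := (w : Pn n))
          (Finset.mem_erase.2 ⟨hw', w.2⟩) (hg2 w hw').1, zero_mul]
      rw [this, mul_zero]
  rw [hilb, htop, finrank_top]
  simp

theorem eval_smul_hom {n : ℕ} (g : MvPolynomial (Fin (n + 1)) ℂ) (k : ℕ) (hg : g.IsHomogeneous k)
    (a : ℂ) (v : Fin (n + 1) → ℂ) :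
    MvPolynomial.eval (a • v) g = a ^ k * MvPolynomial.eval v g := by
  rw [MvPolynomial.eval_eq', MvPolynomial.eval_eq', Finset.mul_sum]
  refine Finset.sum_congr rfl fun m hm => ?_
  have hd : ∑ i, m i = k := by
    have := hg (mem_support_iff.1 hm)
    rw [← this, Finsupp.weight_apply, Finsupp.sum_fintype]
    · simp
    · simp
  simp only [Pi.smul_apply, smul_eq_mul, mul_pow, Finset.prod_mul_distrib,
    Finset.prod_pow_eq_pow_sum, hd]
  ring

theorem rad_mem {n : ℕ} (Z : Finset (Pn n)) (d : Fin n → ℕ)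
    (f : Fin n → MvPolynomial (Fin (n + 1)) ℂ) (hf : ∀ i, (f i).IsHomogeneous (d i))
    (hzero : ∀ P : Pn n, P ∈ Z ↔ ∀ i, evalAt P.rep (f i) = 0)
    (l : MvPolynomial (Fin (n + 1)) ℂ)
    (hl : l.IsHomogeneous 1) (hne : ∀ y ∈ Z, MvPolynomial.eval y.rep l ≠ 0)
    (i : Fin (n + 1)) :
    (X i : MvPolynomial (Fin (n + 1)) ℂ) ∈ (Ideal.span (Set.range
      (Fin.cons l f : Fin (n + 1) → MvPolynomial (Fin (n + 1)) ℂ))).radical := by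
  rw [← MvPolynomial.vanishingIdeal_zeroLocus_eq_radical (K := ℂ), mem_vanishingIdeal_iff]
  intro v hv
  rw [zeroLocus_span] at hv
  have hv' : ∀ j, MvPolynomial.eval v
      ((Fin.cons l f : Fin (n + 1) → MvPolynomial (Fin (n + 1)) ℂ) j) = 0 := by
    intro j
    have := hv _ ⟨j, rfl⟩
    rwa [aeval_eq_eval] at this
  have hv0 : v = 0 := by
    by_contra hv0
    obtain ⟨a, ha⟩ := Projectivization.exists_smul_eq_mk_rep ℂ v hv0
    have hsc : ∀ (g : MvPolynomial (Fin (n + 1)) ℂ) (k : ℕ), g.IsHomogeneous k →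
        MvPolynomial.eval v g = 0 →
        MvPolynomial.eval (Projectivization.mk ℂ v hv0).rep g = 0 := by
      intro g k hg h
      rw [← ha]
      have h' := eval_smul_hom g k hg (a : ℂ) v
      rw [h, mul_zero] at h'
      exact h'
    have hP : Projectivization.mk ℂ v hv0 ∈ Z := by
      rw [hzero]
      intro j
      rw [evalAt_eq]
      refine hsc _ _ (hf j) ?_
      simpa using hv' j.succ
    refine hne _ hP (hsc _ _ hl ?_)
    simpa using hv' 0
  simp [hv0]

theorem pairing {σ K : Type*} [Finite σ] [Field K] (τ : MvPolynomial σ K →ₗ[K] K)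
    (Θ LA LB : Ideal (MvPolynomial σ K)) (i j : ℕ)
    (h0 : ∀ a ∈ LA, ∀ b ∈ LB, a.IsHomogeneous j → b.IsHomogeneous i → τ (b * a) = 0)
    (hnd : ∀ u : MvPolynomial σ K, u.IsHomogeneous i →
      (∀ v : MvPolynomial σ K, v.IsHomogeneous j → τ (u * v) = 0) → u ∈ Θ) :
    HF Θ i ≤ HF LB i + HF LA j := by
  let L : MvPolynomial σ K →ₗ[K] Module.Dual K (homogeneousSubmodule σ K j) :=
    LinearMap.mk₂ K (fun u (v : homogeneousSubmodule σ K j) => τ (u * v))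
      (fun a b c => by simp [add_mul]) (fun c a b => by simp)
      (fun a b c => by simp [mul_add]) (fun c a b => by simp)
  have : FiniteDimensional K (homogeneousSubmodule σ K i ⊓ LB.restrictScalars K :
      Submodule K (MvPolynomial σ K)) := Submodule.finiteDimensional_of_le inf_le_left
  have : FiniteDimensional K (homogeneousSubmodule σ K i ⊓ Θ.restrictScalars K :
      Submodule K (MvPolynomial σ K)) := Submodule.finiteDimensional_of_le inf_le_left
  have h1 := rank_null L (homogeneousSubmodule σ K i ⊓ LB.restrictScalars K)
  let W := (homogeneousSubmodule σ K j ⊓ LA.restrictScalars K).comap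
    (homogeneousSubmodule σ K j).subtype
  have h2 : Module.finrank K ((homogeneousSubmodule σ K i ⊓ LB.restrictScalars K).map L) ≤
      Module.finrank K W.dualAnnihilator := by
    apply Submodule.finrank_mono
    rintro _ ⟨u, ⟨hu, hu'⟩, rfl⟩
    rw [Submodule.mem_dualAnnihilator]
    rintro ⟨w, hw⟩ ⟨_, hw'⟩
    exact h0 w hw' u hu' hw hu
  have h3 : Module.finrank K W + Module.finrank K W.dualAnnihilator =
      Module.finrank K (homogeneousSubmodule σ K j) :=
    Subspace.finrank_add_finrank_dualAnnihilator_eq W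
  have h4 : Module.finrank K W = Module.finrank K
      (homogeneousSubmodule σ K j ⊓ LA.restrictScalars K : Submodule K (MvPolynomial σ K)) :=
    (Submodule.comapSubtypeEquivOfLe inf_le_left).finrank_eq
  have h5 : Module.finrank K (homogeneousSubmodule σ K i ⊓ LB.restrictScalars K ⊓
      LinearMap.ker L : Submodule K (MvPolynomial σ K)) ≤ Module.finrank K
      (homogeneousSubmodule σ K i ⊓ Θ.restrictScalars K : Submodule K (MvPolynomial σ K)) := by
    apply Submodule.finrank_mono
    rintro u ⟨⟨hu, _⟩, hk⟩
    refine ⟨hu, hnd u hu fun v hv => ?_⟩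
    exact LinearMap.congr_fun (LinearMap.mem_ker.1 hk) ⟨v, hv⟩
  have e1 := HF_add Θ i
  have e2 := HF_add LB i
  have e3 := HF_add LA j
  omega

/-- The pure counting step. -/
theorem counting (s M : ℕ) (a b c : ℕ → ℕ) (hs : s + 1 ≤ M) (α β : ℕ)
    (ha : ∀ N ≥ M, ∑ i ∈ Finset.range N, a i ≤ α) (hb : ∀ N ≥ M, ∑ i ∈ Finset.range N, b i ≤ β)
    (hc : ∑ i ∈ Finset.range M, c i = α + β)
    (hc0 : ∀ i, s < i → c i = 0)
    (h : ∀ i ≤ s, c i ≤ b i + a (s - i)) : ∀ i ≤ s, b i + a (s - i) = c i := by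
  have h1 : ∑ i ∈ Finset.range (s + 1), a i ≤ α :=
    (Finset.sum_le_sum_of_subset (Finset.range_subset_range.2 hs)).trans (ha M le_rfl)
  have h2 : ∑ i ∈ Finset.range (s + 1), b i ≤ β :=
    (Finset.sum_le_sum_of_subset (Finset.range_subset_range.2 hs)).trans (hb M le_rfl)
  have h3 : ∑ i ∈ Finset.range (s + 1), c i = α + β := by
    rw [← hc]
    refine Finset.sum_subset (Finset.range_subset_range.2 hs) fun i _ hi => hc0 i ?_
    simpa using hi
  have h4 : ∑ i ∈ Finset.range (s + 1), a (s - i) = ∑ i ∈ Finset.range (s + 1), a i := by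
    rw [← Finset.sum_range_reflect a]
    exact Finset.sum_congr rfl fun i _ => by simp
  have h5 : ∀ i ∈ Finset.range (s + 1), c i ≤ b i + a (s - i) := fun i hi =>
    h i (by simpa [Nat.lt_succ_iff] using hi)
  have h6 : ∑ i ∈ Finset.range (s + 1), c i = ∑ i ∈ Finset.range (s + 1), (b i + a (s - i)) := by
    refine le_antisymm (Finset.sum_le_sum h5) ?_
    rw [Finset.sum_add_distrib]
    omega
  intro i hi
  exact ((Finset.sum_eq_sum_iff_of_le h5).1 h6 i (by simpa [Nat.lt_succ_iff] using hi)).symm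

theorem hilb_empty {n : ℕ} (i : ℕ) : hilb (∅ : Finset (Pn n)) i = 0 := by
  have := hilb_le (∅ : Finset (Pn n)) i
  simpa using this

theorem Dh_empty {n : ℕ} (i : ℕ) : Dh (∅ : Finset (Pn n)) i = 0 := by
  cases i <;> simp [Dh, hilb_empty]

theorem main {n : ℕ} (A B Z : Finset (Pn n)) (hZ : Z = A ∪ B) (hd : Disjoint A B)
    (d : Fin n → ℕ) (f : Fin n → MvPolynomial (Fin (n + 1)) ℂ)
    (hf : ∀ i, (f i).IsHomogeneous (d i))
    (hzero : ∀ P : Pn n, P ∈ Z ↔ ∀ i, evalAt P.rep (f i) = 0)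
    (hcard : Z.card = ∏ i, d i) (hpos : ∀ i, 0 < d i) :
    (∀ i, ∑ j, d j < i + n → Dh A i = 0 ∧ Dh B i = 0 ∧ Dh Z i = 0) ∧
    ∀ i ≤ ∑ j, d j - n, Dh B i + Dh A (∑ j, d j - n - i) = Dh Z i := by
  obtain ⟨φ, hφ⟩ := Module.exists_dual_forall_apply_ne_zero (K := ℂ)
    (fun z : Z => (z : Pn n).rep) (fun z => Projectivization.rep_nonzero _)
  set l := lin φ with hl_def
  have hl : l.IsHomogeneous 1 := lin_hom φ
  have hneZ : ∀ y ∈ Z, MvPolynomial.eval y.rep l ≠ 0 := fun y hy => by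
    rw [hl_def, eval_lin]; exact hφ ⟨y, hy⟩
  have hAZ : A ⊆ Z := hZ ▸ Finset.subset_union_left
  have hBZ : B ⊆ Z := hZ ▸ Finset.subset_union_right
  have hneA : ∀ y ∈ A, MvPolynomial.eval y.rep l ≠ 0 := fun y hy => hneZ y (hAZ hy)
  have hneB : ∀ y ∈ B, MvPolynomial.eval y.rep l ≠ 0 := fun y hy => hneZ y (hBZ hy)
  let θ : Fin (n + 1) → MvPolynomial (Fin (n + 1)) ℂ := Fin.cons l f
  let e : Fin (n + 1) → ℕ := Fin.cons 1 d
  have hθ : ∀ j, (θ j).IsHomogeneous (e j) := fun j => by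
    refine Fin.cases ?_ (fun j => ?_) j
    · exact hl
    · exact hf j
  have he : ∀ j, 0 < e j := fun j => by
    refine Fin.cases ?_ (fun j => ?_) j
    · exact one_pos
    · exact hpos j
  have hr : ∀ i, X i ∈ (Ideal.span (Set.range θ)).radical :=
    fun i => rad_mem Z d f hf hzero l hl hneZ i
  have hsum : ∑ j, e j = 1 + ∑ j, d j := by simp [e, Fin.sum_univ_succ]
  have hprod : ∏ j, e j = Z.card := by rw [hcard]; simp [e, Fin.prod_univ_succ]
  have hns : n ≤ ∑ j, d j := by
    calc n = ∑ _j : Fin n, 1 := by simp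
      _ ≤ _ := Finset.sum_le_sum fun j _ => hpos j
  have hIanti : ∀ Y : Finset (Pn n), Y ⊆ Z → IY Z ≤ IY Y := fun Y hY =>
    Ideal.span_mono fun g hg => ⟨hg.1, fun y hy => hg.2 y (hY hy)⟩
  have hΘZ : Ideal.span (Set.range θ) ≤ IY Z ⊔ Ideal.span {l} := by
    rw [Ideal.span_le]
    rintro _ ⟨j, rfl⟩
    refine Fin.cases ?_ (fun j => ?_) j
    · exact (le_sup_right : Ideal.span {l} ≤ _) (Ideal.mem_span_singleton_self l)
    · refine (le_sup_left : IY Z ≤ _) ((mem_IY Z (f j) _ (hf j)).2 fun y hy => ?_)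
      rw [← evalAt_eq]
      exact (hzero y).1 hy j
  obtain ⟨M₀, hM₀⟩ := sum_HF θ e hθ he hr
  have hDle : ∀ Y : Finset (Pn n), (∀ y ∈ Y, MvPolynomial.eval y.rep l ≠ 0) → ∀ N ≥ 1,
      ∑ i ∈ Finset.range N, Dh Y i ≤ Y.card := by
    intro Y hY N hN
    obtain ⟨N, rfl⟩ : ∃ k, N = k + 1 := ⟨N - 1, by omega⟩
    rw [sum_Dh Y l hl hY]
    exact hilb_le Y N
  have hDZ : ∀ N, Z.card < N → ∑ i ∈ Finset.range N, Dh Z i = Z.card := by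
    intro N hN
    obtain ⟨N, rfl⟩ : ∃ k, N = k + 1 := ⟨N - 1, by omega⟩
    rw [sum_Dh Z l hl hneZ]
    exact hilb_large Z l hl hneZ N (by omega)
  have hHF : ∀ i, HF (Ideal.span (Set.range θ)) i = Dh Z i := by
    intro i
    have hle : ∀ m ∈ Finset.range (M₀ + Z.card + i + 1),
        Dh Z m ≤ HF (Ideal.span (Set.range θ)) m := fun m _ => by
      rw [Dh_eq Z l hl hneZ]
      exact HF_mono _ _ hΘZ m
    have h1 := hM₀ (M₀ + Z.card + i + 1) (by omega)
    have h2 := hDZ (M₀ + Z.card + i + 1) (by omega)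
    have h3 := h2.trans (hprod.symm.trans h1.symm)
    exact ((Finset.sum_eq_sum_iff_of_le hle).1 h3 i (Finset.mem_range.2 (by omega))).symm
  have hLZ : ∀ k u, u.IsHomogeneous k → u ∈ IY Z ⊔ Ideal.span {l} →
      u ∈ Ideal.span (Set.range θ) := fun k u hu h =>
    mem_of_HF_eq _ _ hΘZ k (by rw [hHF, Dh_eq Z l hl hneZ]) u hu h
  have hvan : ∀ i, ∑ j, d j < i + n → Dh A i = 0 ∧ Dh B i = 0 ∧ Dh Z i = 0 := by
    intro i hi
    have h0 : HF (Ideal.span (Set.range θ)) i = 0 := HF_of_ge _ _ fun u hu =>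
      mem_of_degree_gt θ e hθ hr i u hu (by rw [hsum, Fintype.card_fin]; omega)
    have hmono : ∀ Y : Finset (Pn n), Y ⊆ Z → Dh Y i = 0 := fun Y hY => by
      rw [Dh_eq Y l hl (fun y hy => hneZ y (hY hy))]
      have := HF_mono _ _ (hΘZ.trans (sup_le_sup_right (hIanti Y hY) (Ideal.span {l}))) i
      omega
    exact ⟨hmono A hAZ, hmono B hBZ, hmono Z subset_rfl⟩
  refine ⟨hvan, ?_⟩
  have hmul : IY B * IY A ≤ IY Z := by
    rw [IY, IY, Ideal.span_mul_span', Ideal.span_le]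
    rintro _ ⟨b, ⟨⟨k, hk⟩, hb⟩, a, ⟨⟨m, hm⟩, ha⟩, rfl⟩
    refine Ideal.subset_span ⟨⟨_, hk.mul hm⟩, fun y hy => ?_⟩
    simp only [map_mul]
    rw [hZ, Finset.mem_union] at hy
    rcases hy with hy | hy
    · rw [ha y hy, mul_zero]
    · rw [hb y hy, zero_mul]
  have hmulL : ∀ a ∈ IY A ⊔ Ideal.span {l}, ∀ b ∈ IY B ⊔ Ideal.span {l},
      b * a ∈ IY Z ⊔ Ideal.span {l} := by
    intro a ha b hb
    obtain ⟨a₁, ha₁, a₂, rfl⟩ := mem_sup_comp _ (IY_hom A) l a ha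
    obtain ⟨b₁, hb₁, b₂, rfl⟩ := mem_sup_comp _ (IY_hom B) l b hb
    refine Submodule.mem_sup.2 ⟨b₁ * a₁, hmul (Ideal.mul_mem_mul hb₁ ha₁),
      (b₁ * a₂ + b₂ * (a₁ + a₂ * l)) * l, Ideal.mem_span_singleton'.2 ⟨_, rfl⟩, by ring⟩
  obtain ⟨τ, h1, h2, h3⟩ := frobenius θ e hθ hr
  have hcardAB : Z.card = A.card + B.card := by rw [hZ, Finset.card_union_of_disjoint hd]
  refine counting (∑ j, d j - n) (∑ j, d j + Z.card + 1) (Dh A) (Dh B) (Dh Z) (by omega)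
    A.card B.card (fun N hN => hDle A hneA N (by omega)) (fun N hN => hDle B hneB N (by omega))
    (by rw [hDZ _ (by omega), hcardAB]) (fun i hi => (hvan i (by omega)).2.2) ?_
  intro i hi
  rw [← hHF, Dh_eq A l hl hneA, Dh_eq B l hl hneB]
  refine pairing τ _ _ _ _ _ ?_ ?_
  · intro a ha b hb hja hib
    exact h1 _ (hLZ _ _ (hib.mul hja) (hmulL a ha b hb))
  · intro u hu h
    refine nondeg τ _ (∑ j, e j) h2 h3 i u hu fun j v hv hj => h v ?_
    rw [hsum, Fintype.card_fin] at hj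
    have : j = ∑ j, d j - n - i := by omega
    rwa [this] at hv

end Liaison

/-- liaison formula. If disjoint finite sets `A, B ⊂ ℙⁿ` are linked
by a reduced zero-dimensional complete intersection `Z = A ∪ B` of type `(d₁,…,dₙ)`,
then `Dh_B(i) + Dh_A(d₁+⋯+dₙ-n-i) = Dh_Z(i)` for every integer `i`. -/
theorem stmt7 (n : ℕ) (A B Z : Finset (Pn n)) (hZ : Z = A ∪ B) (hd : Disjoint A B)
    (d : Fin n → ℕ) (f : Fin n → MvPolynomial (Fin (n + 1)) ℂ)
    (hf : ∀ i, (f i).IsHomogeneous (d i))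
    (hzero : ∀ P : Pn n, P ∈ Z ↔ ∀ i, evalAt P.rep (f i) = 0)
    (hcard : Z.card = ∏ i, d i) :
    ∀ i : ℤ, DhZint B i + DhZint A ((∑ j, (d j : ℤ)) - n - i) = DhZint Z i := by
  intro i
  by_cases hpos : ∀ j, 0 < d j
  · obtain ⟨h0, h⟩ := Liaison.main A B Z hZ hd d f hf hzero hcard hpos
    have hns : n ≤ ∑ j, d j := by
      calc n = ∑ _j : Fin n, 1 := by simp
        _ ≤ _ := Finset.sum_le_sum fun j _ => hpos j
    have hc : (∑ j, (d j : ℤ)) = ((∑ j, d j : ℕ) : ℤ) := by push_cast; rfl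
    rw [hc]
    generalize ∑ j, d j = S at *
    unfold DhZint
    by_cases hi : 0 ≤ i
    · obtain ⟨k, rfl⟩ := Int.eq_ofNat_of_zero_le hi
      rw [if_pos hi, if_pos hi, Int.toNat_natCast]
      split_ifs with h1
      · have : ((S : ℤ) - n - k).toNat = S - n - k := by omega
        rw [this]
        exact h k (by omega)
      · obtain ⟨_, hb, hz⟩ := h0 k (by omega)
        rw [hb, hz]
    · rw [if_neg hi, if_neg hi]
      split_ifs with h1
      · rw [(h0 _ (by omega)).1]
      · rfl
  · push Not at hpos
    obtain ⟨j, hj⟩ := hpos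
    have hZ0 : Z = ∅ := by
      rw [← Finset.card_eq_zero, hcard]
      exact Finset.prod_eq_zero (Finset.mem_univ j) (by omega)
    have hAB : A = ∅ ∧ B = ∅ := by
      rw [hZ] at hZ0
      exact Finset.union_eq_empty.1 hZ0
    obtain ⟨rfl, rfl⟩ := hAB
    subst hZ0
    simp [DhZint, Liaison.Dh_empty]
end
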